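/- Let n ≥ 3 and let (p,q) be any Schrödinger-admissible pair in dimension n (including the endpoint p = 2, q = 2n/(n−2)). There is a constant C = C(n,p) such that for every measurable w : ℝ^n → ℂ with |w(x)| ≤ ⟨x⟩^{-1} for all x, and every Schwartz function g on ℝ × ℝ^n, the function F(t,x) = ∫_ℝ [ e^{i(t−s)Δ}( w · g(s,·) ) ](x) ds satisfies ‖F‖_{L^p_t L^q_x} ≤ C ‖g‖_{L²(ℝ×ℝ^n)}. -/

import Mathlib

open MeasureTheory ENNReal SchwartzMap

/-- The free Schrödinger evolution `(e^{itΔ}f)(x)`, given for `t ≠ 0` by the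
explicit convolution formula with the principal branch of the complex power. -/
noncomputable def schrod (n : ℕ) (t : ℝ) (f : EuclideanSpace ℝ (Fin n) → ℂ)
    (x : EuclideanSpace ℝ (Fin n)) : ℂ :=
  if t = 0 then f x
  else (4 * Real.pi * Complex.I * (t : ℂ)) ^ (-(n : ℂ) / 2) *
    ∫ y : EuclideanSpace ℝ (Fin n),
      Complex.exp (Complex.I * (‖x - y‖ : ℂ) ^ 2 / (4 * (t : ℂ))) * f y

/-- The mixed norm `‖F‖_{L^p_t L^q_x}`, with exponents in `ℝ≥0∞`. -/
noncomputable def mixedNorm {n : ℕ} (p q : ℝ≥0∞)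
    (F : ℝ → EuclideanSpace ℝ (Fin n) → ℂ) : ℝ≥0∞ :=
  if p = ⊤ then essSup (fun t => eLpNorm (F t) q volume) volume
  else (∫⁻ t : ℝ, (eLpNorm (F t) q volume) ^ p.toReal) ^ (1 / p.toReal)

open scoped ComplexConjugate FourierTransform
open Filter Topology

/-- Euclidean space of dimension `n`. -/
abbrev Rn (n : ℕ) := EuclideanSpace ℝ (Fin n)


section Fourier

variable {n : ℕ}

theorem continuous_fourier_of_integrable {f : Rn n → ℂ} (hf : Integrable f) :
    Continuous (𝓕 f) :=
  VectorFourier.fourierIntegral_continuous Real.continuous_fourierChar continuous_inner hf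

theorem norm_fourier_le_integral_norm (f : Rn n → ℂ) (ξ : Rn n) :
    ‖𝓕 f ξ‖ ≤ ∫ x, ‖f x‖ :=
  VectorFourier.norm_fourierIntegral_le_integral_norm _ _ _ _ _

theorem integral_fourier_mul_eq_flip {f g : Rn n → ℂ} (hf : Integrable f) (hg : Integrable g) :
    ∫ ξ, 𝓕 f ξ * g ξ = ∫ x, f x * 𝓕 g x := by
  have := VectorFourier.integral_fourierIntegral_smul_eq_flip (L := innerₗ (Rn n))
    Real.continuous_fourierChar continuous_inner hf hg
  rw [flip_innerₗ] at this
  exact this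

theorem integrable_gaussian {b : ℂ} (hb : 0 < b.re) :
    Integrable (fun v : Rn n => Complex.exp (-b * ‖v‖ ^ 2)) := by
  simpa using GaussianFourier.integrable_cexp_neg_mul_sq_norm_add hb 0 (0 : Rn n)

theorem fourier_gaussian_mul_conj_fourier {b : ℂ} (hb : 0 < b.re) {h : Rn n → ℂ}
    (hh : Integrable h) (y : Rn n) :
    𝓕 (fun ξ => Complex.exp (-b * ‖ξ‖ ^ 2) * conj (𝓕 h ξ)) y =
      ((Real.pi : ℂ) / b) ^ ((n : ℂ) / 2) *
        ∫ x, Complex.exp (-Real.pi ^ 2 * ‖x - y‖ ^ 2 / b) * conj (h x) := by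
  have hb' : 0 < (conj b).re := by simpa using hb
  have key := integral_fourier_mul_eq_flip (f := h) hh
    (GaussianFourier.integrable_cexp_neg_mul_sq_norm_add hb' (2 * Real.pi * Complex.I) y)
  have e1 : 𝓕 (fun v : Rn n => Complex.exp (-(conj b) * ‖v‖ ^ 2 +
      2 * Real.pi * Complex.I * inner ℝ y v)) = _ :=
    funext fun w => fourier_gaussian_innerProductSpace' hb' y w
  rw [e1] at key
  have key2 := congrArg conj key
  rw [← integral_conj, ← integral_conj] at key2
  rw [Real.fourier_eq', ← integral_const_mul]
  have harg : ((Real.pi : ℂ) / conj b).arg ≠ Real.pi := by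
    rw [Ne, Complex.arg_eq_pi_iff, not_and_or, not_lt]
    left
    rw [Complex.div_re]
    have : b ≠ 0 := by rintro rfl; simp at hb
    have := Complex.normSq_pos.2 this
    simp only [Complex.ofReal_re, Complex.conj_re, Complex.normSq_conj, Complex.ofReal_im,
      zero_mul, zero_div, add_zero]
    positivity
  have hpow : conj (((Real.pi : ℂ) / conj b) ^ ((n : ℂ) / 2)) =
      ((Real.pi : ℂ) / b) ^ ((n : ℂ) / 2) := by
    have := Complex.conj_cpow _ ((n : ℂ) / 2) harg
    simp only [map_div₀, Complex.conj_conj, Complex.conj_ofReal, map_natCast, map_ofNat] at this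
    exact this.symm
  calc _ = _ := by
        refine integral_congr_ae (ae_of_all _ fun ξ => ?_)
        simp only [smul_eq_mul]
        rw [← mul_assoc, ← Complex.exp_add]
        rw [map_mul, ← Complex.exp_conj, mul_comm]
        congr 2
        simp [real_inner_comm, map_ofNat]
        ring
    _ = _ := key2
    _ = _ := by
        refine integral_congr_ae (ae_of_all _ fun x => ?_)
        simp only [map_mul, finrank_euclideanSpace, Fintype.card_fin]
        rw [hpow, ← Complex.exp_conj, norm_sub_rev]
        simp
        ring

/-- The Fourier multiplier `e^{-b|ξ|²}` as convolution with a complex Gaussian. -/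
theorem integral_gaussian_mul_fourier {b : ℂ} (hb : 0 < b.re) {f h : Rn n → ℂ}
    (hf : Integrable f) (hh : Integrable h) :
    ∫ ξ, Complex.exp (-b * ‖ξ‖ ^ 2) * (𝓕 f ξ * conj (𝓕 h ξ)) =
      ((Real.pi : ℂ) / b) ^ ((n : ℂ) / 2) *
        ∫ y, f y * ∫ x, Complex.exp (-Real.pi ^ 2 * ‖x - y‖ ^ 2 / b) * conj (h x) := by
  have hg : Integrable (fun ξ => Complex.exp (-b * ‖ξ‖ ^ 2) * conj (𝓕 h ξ)) := by
    refine (integrable_gaussian hb).mul_bdd (c := ∫ x, ‖h x‖) ?_ (ae_of_all _ fun ξ => ?_)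
    · exact (Complex.continuous_conj.comp (continuous_fourier_of_integrable hh)).aestronglyMeasurable
    · simpa using norm_fourier_le_integral_norm h ξ
  calc _ = ∫ ξ, 𝓕 f ξ * (Complex.exp (-b * ‖ξ‖ ^ 2) * conj (𝓕 h ξ)) := by
        congr 1; ext ξ; ring
    _ = _ := by
        rw [integral_fourier_mul_eq_flip hf hg, ← integral_const_mul]
        congr 1; ext y
        rw [fourier_gaussian_mul_conj_fourier hb hh]
        ring

end Fourier

section Lintegral

theorem eLpNorm_two_sq {α : Type*} [MeasurableSpace α] {μ : Measure α} (f : α → ℂ) :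
    eLpNorm f 2 μ ^ 2 = ∫⁻ x, ‖f x‖ₑ ^ 2 ∂μ := by
  rw [eLpNorm_eq_lintegral_rpow_enorm_toReal (by norm_num) (by norm_num), ← ENNReal.rpow_natCast,
    ← ENNReal.rpow_mul]
  simp

theorem eLpNorm_two_eq {α : Type*} [MeasurableSpace α] {μ : Measure α} (f : α → ℂ) :
    eLpNorm f 2 μ = (∫⁻ x, ‖f x‖ₑ ^ 2 ∂μ) ^ (1 / 2 : ℝ) := by
  rw [eLpNorm_eq_lintegral_rpow_enorm_toReal (by norm_num) (by norm_num)]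
  simp

theorem ENNReal.rpow_half_sq (a : ℝ≥0∞) : (a ^ (1 / 2 : ℝ)) ^ 2 = a := by
  rw [← ENNReal.rpow_natCast, ← ENNReal.rpow_mul]
  simp

theorem ENNReal.sq_rpow_half (a : ℝ≥0∞) : (a ^ 2) ^ (1 / 2 : ℝ) = a := by
  rw [← ENNReal.rpow_natCast, ← ENNReal.rpow_mul]
  simp

theorem ENNReal.rpow_half_mul_self (a : ℝ≥0∞) : a ^ (1 / 2 : ℝ) * a ^ (1 / 2 : ℝ) = a := by
  rw [← sq, rpow_half_sq]

theorem lintegral_mul_le_rpow_half {α : Type*} [MeasurableSpace α] {μ : Measure α}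
    {c d : α → ℝ≥0∞} (hc : AEMeasurable c μ) (hd : AEMeasurable d μ) :
    ∫⁻ x, c x * d x ∂μ ≤
      (∫⁻ x, c x ^ 2 ∂μ) ^ (1 / 2 : ℝ) * (∫⁻ x, d x ^ 2 ∂μ) ^ (1 / 2 : ℝ) := by
  simpa using ENNReal.lintegral_mul_le_Lp_mul_Lq μ Real.HolderConjugate.two_two hc hd

/-- A bilinear form of Young's inequality. -/
theorem lintegral_kernel_mul_le {V : Type*} [AddCommGroup V] [MeasurableSpace V]
    [MeasurableAdd₂ V] [MeasurableSub₂ V] {μ : Measure V} [SFinite μ] [μ.IsAddLeftInvariant]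
    {k c d : V → ℝ≥0∞} (hk : Measurable k) (hc : Measurable c) (hd : Measurable d) :
    ∫⁻ y, ∫⁻ x, k (x - y) * c y * d x ∂μ ∂μ ≤
      (∫⁻ z, k z ∂μ) * ((∫⁻ x, c x ^ 2 ∂μ) ^ (1 / 2 : ℝ) * (∫⁻ x, d x ^ 2 ∂μ) ^ (1 / 2 : ℝ)) := by
  calc ∫⁻ y, ∫⁻ x, k (x - y) * c y * d x ∂μ ∂μ
      = ∫⁻ y, ∫⁻ z, k z * (c y * d (y + z)) ∂μ ∂μ := by
        congr 1; ext y
        rw [← lintegral_add_left_eq_self _ y]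
        simp [mul_assoc]
    _ = ∫⁻ z, k z * ∫⁻ y, c y * d (z + y) ∂μ ∂μ := by
        rw [lintegral_lintegral_swap (by fun_prop)]
        congr 1; ext z
        rw [lintegral_const_mul _ (by fun_prop)]
        simp [add_comm]
    _ ≤ ∫⁻ z, k z * ((∫⁻ x, c x ^ 2 ∂μ) ^ (1 / 2 : ℝ) * (∫⁻ x, d x ^ 2 ∂μ) ^ (1 / 2 : ℝ)) ∂μ := by
        gcongr with z
        refine (lintegral_mul_le_rpow_half (by fun_prop) (by fun_prop)).trans_eq ?_
        rw [lintegral_add_left_eq_self (fun y => d y ^ 2) z]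
    _ = _ := lintegral_mul_const _ hk

theorem lintegral_le_of_tendsto {α : Type*} [MeasurableSpace α] {μ : Measure α}
    {u : ℕ → α → ℝ≥0∞} {v : α → ℝ≥0∞} {C : ℝ≥0∞} (hu : ∀ m, AEMeasurable (u m) μ)
    (hlim : ∀ᵐ x ∂μ, Tendsto (fun m => u m x) atTop (𝓝 (v x))) (hC : ∀ m, ∫⁻ x, u m x ∂μ ≤ C) :
    ∫⁻ x, v x ∂μ ≤ C := by
  calc ∫⁻ x, v x ∂μ = ∫⁻ x, liminf (fun m => u m x) atTop ∂μ :=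
        lintegral_congr_ae (hlim.mono fun x hx => hx.liminf_eq.symm)
    _ ≤ liminf (fun m => ∫⁻ x, u m x ∂μ) atTop := lintegral_liminf_le' hu
    _ ≤ C := (liminf_le_liminf (Eventually.of_forall hC)).trans (by simp)

end Lintegral

section Bessel

variable {n : ℕ}

theorem lintegral_gaussian_normalized {b : ℝ} (hb : 0 < b) :
    ∫⁻ z : Rn n, ENNReal.ofReal ((Real.pi / b) ^ ((n : ℝ) / 2) *
      Real.exp (-(Real.pi ^ 2 / b) * ‖z‖ ^ 2)) = 1 := by
  have hb2 : 0 < Real.pi ^ 2 / b := by positivity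
  have hint : Integrable fun z : Rn n => Real.exp (-(Real.pi ^ 2 / b) * ‖z‖ ^ 2) := by
    have := (integrable_gaussian (n := n) (b := ((Real.pi ^ 2 / b : ℝ) : ℂ))
      (by simpa only [Complex.ofReal_re])).norm
    refine this.congr (ae_of_all _ fun z => ?_)
    simp only [Complex.norm_exp]
    norm_cast
  rw [← ofReal_integral_eq_lintegral_ofReal (hint.const_mul _)
    (ae_of_all _ fun z => by positivity), integral_const_mul,
    GaussianFourier.integral_rexp_neg_mul_sq_norm hb2]
  rw [finrank_euclideanSpace, Fintype.card_fin, ← Real.mul_rpow (by positivity) (by positivity)]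
  have : Real.pi / b * (Real.pi / (Real.pi ^ 2 / b)) = 1 := by field_simp
  simp [this]

theorem lintegral_gaussian_mul_fourier_sq_le {f : Rn n → ℂ} (hf : Integrable f)
    {b : ℝ} (hb : 0 < b) :
    ∫⁻ ξ, ENNReal.ofReal (Real.exp (-b * ‖ξ‖ ^ 2)) * ‖𝓕 f ξ‖ₑ ^ 2 ≤ ∫⁻ x, ‖f x‖ₑ ^ 2 := by
  have hid := integral_gaussian_mul_fourier (b := (b : ℂ)) (by simpa) hf hf
  have e1 : ∀ ξ : Rn n, Complex.exp (-(b : ℂ) * ‖ξ‖ ^ 2) * (𝓕 f ξ * conj (𝓕 f ξ)) =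
      ((Real.exp (-b * ‖ξ‖ ^ 2) * ‖𝓕 f ξ‖ ^ 2 : ℝ) : ℂ) := fun ξ => by
    rw [Complex.mul_conj, Complex.normSq_eq_norm_sq]
    push_cast
    rfl
  have hint : Integrable fun ξ => Real.exp (-b * ‖ξ‖ ^ 2) * ‖𝓕 f ξ‖ ^ 2 := by
    have h1 : Integrable (fun ξ : Rn n => Real.exp (-b * ‖ξ‖ ^ 2)) := by
      have := (integrable_gaussian (n := n) (b := (b : ℂ)) (by simpa)).norm
      refine this.congr (ae_of_all _ fun z => ?_)
      simp only [Complex.norm_exp]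
      norm_cast
    refine h1.mul_bdd (c := (∫ x, ‖f x‖) ^ 2) ?_ (ae_of_all _ fun ξ => ?_)
    · exact ((continuous_fourier_of_integrable hf).norm.pow 2).aestronglyMeasurable
    · rw [norm_pow, norm_norm]
      gcongr
      exact norm_fourier_le_integral_norm f ξ
  rw [integral_congr_ae (ae_of_all _ e1), integral_complex_ofReal] at hid
  have hL : ∫⁻ ξ, ENNReal.ofReal (Real.exp (-b * ‖ξ‖ ^ 2)) * ‖𝓕 f ξ‖ₑ ^ 2 =
      ‖((∫ ξ, Real.exp (-b * ‖ξ‖ ^ 2) * ‖𝓕 f ξ‖ ^ 2 : ℝ) : ℂ)‖ₑ := by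
    rw [← ofReal_norm, Complex.norm_real, Real.norm_of_nonneg (by positivity),
      ofReal_integral_eq_lintegral_ofReal hint (ae_of_all _ fun ξ => by positivity)]
    congr 1; ext ξ
    rw [ENNReal.ofReal_mul (by positivity), ENNReal.ofReal_pow (by positivity), ofReal_norm]
  -- pass to a measurable representative
  obtain ⟨g, hg, hfg⟩ := hf.aestronglyMeasurable
  have hgm := hg.measurable
  have hsq : ∫⁻ x, ‖f x‖ₑ ^ 2 = ∫⁻ x, ‖g x‖ₑ ^ 2 :=
    lintegral_congr_ae (hfg.mono fun x hx => by simp [hx])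
  rw [hL, hid, hsq]
  calc _ ≤ ∫⁻ y, ∫⁻ x, ENNReal.ofReal ((Real.pi / b) ^ ((n : ℝ) / 2) *
      Real.exp (-(Real.pi ^ 2 / b) * ‖x - y‖ ^ 2)) * ‖g y‖ₑ * ‖g x‖ₑ := by
        rw [← integral_const_mul]
        refine (enorm_integral_le_lintegral_enorm _).trans ?_
        refine lintegral_mono_ae (hfg.mono fun y hy => ?_)
        have hk : ∀ x : Rn n, ENNReal.ofReal ((Real.pi / b) ^ ((n : ℝ) / 2) *
            Real.exp (-(Real.pi ^ 2 / b) * ‖x - y‖ ^ 2)) = ‖((Real.pi : ℂ) / b) ^ ((n : ℂ) / 2)‖ₑ *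
            ‖Complex.exp (-Real.pi ^ 2 * ‖x - y‖ ^ 2 / b)‖ₑ := fun x => by
          rw [ENNReal.ofReal_mul (by positivity), ← ofReal_norm, ← ofReal_norm, Complex.norm_exp]
          congr 2
          · rw [← Complex.ofReal_div, Complex.norm_cpow_eq_rpow_re_of_pos (by positivity)]
            simp
          · congr 1
            norm_cast
            ring
        simp_rw [hk]
        rw [hy, enorm_mul, enorm_mul]
        calc _ ≤ ‖((Real.pi : ℂ) / b) ^ ((n : ℂ) / 2)‖ₑ * (‖g y‖ₑ *
              ∫⁻ x, ‖Complex.exp (-Real.pi ^ 2 * ‖x - y‖ ^ 2 / b) * conj (f x)‖ₑ) := by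
              gcongr
              exact enorm_integral_le_lintegral_enorm _
          _ = ∫⁻ x, ‖((Real.pi : ℂ) / b) ^ ((n : ℂ) / 2)‖ₑ * (‖g y‖ₑ *
              ‖Complex.exp (-Real.pi ^ 2 * ‖x - y‖ ^ 2 / b) * conj (f x)‖ₑ) := by
              rw [lintegral_const_mul' _ _ (by finiteness), lintegral_const_mul' _ _ (by finiteness)]
          _ = _ := by
              refine lintegral_congr_ae (hfg.mono fun x hx => ?_)
              simp only [enorm_mul, RCLike.enorm_conj, hx]
              ring
    _ ≤ _ := lintegral_kernel_mul_le (V := Rn n) (k := fun z => ENNReal.ofReal ((Real.pi / b) ^ ((n : ℝ) / 2) *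
      Real.exp (-(Real.pi ^ 2 / b) * ‖z‖ ^ 2))) (by fun_prop) (by fun_prop) (by fun_prop)
    _ = _ := by
        rw [lintegral_gaussian_normalized hb, one_mul, ENNReal.rpow_half_mul_self]

/-- Bessel's inequality for the Fourier transform on `L¹`. -/
theorem eLpNorm_fourier_le {f : Rn n → ℂ} (hf : Integrable f) :
    eLpNorm (𝓕 f) 2 volume ≤ eLpNorm f 2 volume := by
  rw [eLpNorm_two_eq, eLpNorm_two_eq]
  refine ENNReal.rpow_le_rpow ?_ (by norm_num)
  refine lintegral_le_of_tendsto
    (u := fun m ξ => ENNReal.ofReal (Real.exp (-(1 / ((m : ℝ) + 1)) * ‖ξ‖ ^ 2)) * ‖𝓕 f ξ‖ₑ ^ 2)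
    (fun m => ?_) (ae_of_all _ fun ξ => ?_)
    (fun m => lintegral_gaussian_mul_fourier_sq_le hf (by positivity))
  · have := (continuous_fourier_of_integrable hf).measurable
    fun_prop
  · have h1 : Tendsto (fun m : ℕ => ENNReal.ofReal (Real.exp (-(1 / ((m : ℝ) + 1)) * ‖ξ‖ ^ 2)))
        atTop (𝓝 (ENNReal.ofReal (Real.exp (-0 * ‖ξ‖ ^ 2)))) := by
      refine ENNReal.tendsto_ofReal ((Real.continuous_exp.tendsto _).comp ?_)
      exact (tendsto_one_div_add_atTop_nhds_zero_nat.neg).mul_const _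
    simpa using ENNReal.Tendsto.mul_const h1 (Or.inr (by finiteness))

end Bessel

section Pairing

variable {n : ℕ}

theorem memLp_fourier {f : Rn n → ℂ} (hf : Integrable f) (hf2 : MemLp f 2) :
    MemLp (𝓕 f) 2 :=
  ⟨(continuous_fourier_of_integrable hf).aestronglyMeasurable,
    (eLpNorm_fourier_le hf).trans_lt hf2.2⟩

theorem integrable_kernel_mul {f h : Rn n → ℂ} (hf : Integrable f) (hh : Integrable h)
    {K : Rn n → Rn n → ℂ} (hK : Continuous K.uncurry) (hK1 : ∀ x y, ‖K x y‖ ≤ 1) :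
    Integrable (fun p : Rn n × Rn n => K p.1 p.2 * f p.2 * conj (h p.1)) := by
  have h1 : Integrable (fun p : Rn n × Rn n => conj (h p.1) * f p.2) :=
    ((RCLike.conjCLE (K := ℂ)).toContinuousLinearMap.integrable_comp hh).mul_prod hf
  have := h1.bdd_mul (f := fun p : Rn n × Rn n => K p.1 p.2) (c := 1)
    hK.aestronglyMeasurable (ae_of_all _ fun p => hK1 _ _)
  refine this.congr (ae_of_all _ fun p => ?_)
  simp only
  ring

theorem integral_kernel_swap {f h : Rn n → ℂ} (hf : Integrable f) (hh : Integrable h)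
    {K : Rn n → Rn n → ℂ} (hK : Continuous K.uncurry) (hK1 : ∀ x y, ‖K x y‖ ≤ 1) :
    ∫ y, f y * ∫ x, K x y * conj (h x) =
      ∫ p : Rn n × Rn n, K p.1 p.2 * f p.2 * conj (h p.1) := by
  rw [Measure.volume_eq_prod, integral_prod_symm _ (integrable_kernel_mul hf hh hK hK1)]
  congr 1; ext y
  rw [← integral_const_mul]
  congr 1; ext x
  ring

theorem schrod_kernel_norm (τ : ℝ) (x y : Rn n) :
    ‖Complex.exp (Complex.I * (‖x - y‖ : ℂ) ^ 2 / (4 * (τ : ℂ)))‖ = 1 := by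
  have : Complex.I * (‖x - y‖ : ℂ) ^ 2 / (4 * (τ : ℂ)) =
      ((‖x - y‖ ^ 2 / (4 * τ) : ℝ) : ℂ) * Complex.I := by
    push_cast; ring
  rw [this, Complex.norm_exp_ofReal_mul_I]

/-- The free evolution is the Fourier multiplier `e^{-4π²iτ|ξ|²}`, in weak form. -/
theorem integral_schrod_mul_conj {τ : ℝ} (hτ : τ ≠ 0) {f h : Rn n → ℂ}
    (hf : Integrable f) (hf2 : MemLp f 2) (hh : Integrable h) (hh2 : MemLp h 2) :
    ∫ x, schrod n τ f x * conj (h x) =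
      ∫ ξ, Complex.exp (-((4 * Real.pi ^ 2 * τ * ‖ξ‖ ^ 2 : ℝ) : ℂ) * Complex.I) *
        (𝓕 f ξ * conj (𝓕 h ξ)) := by
  set b : ℕ → ℂ := fun m => ((1 / ((m : ℝ) + 1) : ℝ) : ℂ) + 4 * Real.pi ^ 2 * τ * Complex.I with hbdef
  have hbre : ∀ m, 0 < (b m).re := fun m => by
    have : (b m).re = 1 / ((m : ℝ) + 1) := by
      simp only [hbdef]
      rw [Complex.add_re, Complex.ofReal_re]
      have : (4 * (Real.pi : ℂ) ^ 2 * τ * Complex.I) =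
        ((4 * Real.pi ^ 2 * τ : ℝ) : ℂ) * Complex.I := by push_cast; ring
      rw [this, Complex.re_ofReal_mul]
      simp
    rw [this]
    positivity
  have hπ : (Real.pi : ℂ) ≠ 0 := by exact_mod_cast Real.pi_ne_zero
  have hτ' : (τ : ℂ) ≠ 0 := by exact_mod_cast hτ
  have hlimne : (4 * Real.pi ^ 2 * τ * Complex.I : ℂ) ≠ 0 := by
    simp [hπ, hτ']
  have hblim : Tendsto b atTop (𝓝 (4 * Real.pi ^ 2 * τ * Complex.I)) := by
    have h0 : Tendsto (fun m : ℕ => ((1 / ((m : ℝ) + 1) : ℝ) : ℂ)) atTop (𝓝 ((0 : ℝ) : ℂ)) :=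
      (Complex.continuous_ofReal.tendsto _).comp tendsto_one_div_add_atTop_nhds_zero_nat
    simpa [hbdef] using h0.add_const (4 * Real.pi ^ 2 * τ * Complex.I : ℂ)
  have hR : Tendsto (fun m => ∫ ξ : Rn n, Complex.exp (-b m * ‖ξ‖ ^ 2) * (𝓕 f ξ * conj (𝓕 h ξ)))
      atTop (𝓝 (∫ ξ, Complex.exp (-((4 * Real.pi ^ 2 * τ * ‖ξ‖ ^ 2 : ℝ) : ℂ) * Complex.I) *
        (𝓕 f ξ * conj (𝓕 h ξ)))) := by
    refine tendsto_integral_of_dominated_convergence (fun ξ => ‖𝓕 f ξ‖ * ‖𝓕 h ξ‖) (fun m => ?_) ?_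
      (fun m => ae_of_all _ fun ξ => ?_) (ae_of_all _ fun ξ => ?_)
    · have h1 := continuous_fourier_of_integrable hf
      have h2 := continuous_fourier_of_integrable hh
      have h3 := Complex.continuous_conj.comp h2
      exact Continuous.aestronglyMeasurable (by unfold Function.comp at h3; fun_prop)
    · exact (memLp_fourier hf hf2).norm.integrable_mul (memLp_fourier hh hh2).norm
    · rw [norm_mul, norm_mul, RCLike.norm_conj]
      refine mul_le_of_le_one_left (by positivity) ?_
      rw [Complex.norm_exp, Real.exp_le_one_iff]
      have : (-b m * (‖ξ‖ : ℂ) ^ 2).re = -((b m).re * ‖ξ‖ ^ 2) := by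
        rw [← Complex.ofReal_pow, Complex.re_mul_ofReal, Complex.neg_re]; ring
      rw [this, neg_nonpos]
      have := hbre m
      positivity
    · refine Tendsto.mul_const _ ((Complex.continuous_exp.tendsto _).comp ?_)
      have := (hblim.neg).mul_const ((‖ξ‖ : ℂ) ^ 2)
      convert this using 2
      push_cast
      ring
  have hK : ∀ m : ℕ, Continuous (Function.uncurry fun x y : Rn n =>
      Complex.exp (-Real.pi ^ 2 * ‖x - y‖ ^ 2 / b m)) := fun m => by
    unfold Function.uncurry; fun_prop
  have hK1 : ∀ m (x y : Rn n), ‖Complex.exp (-Real.pi ^ 2 * ‖x - y‖ ^ 2 / b m)‖ ≤ 1 := fun m x y => by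
    rw [Complex.norm_exp, Real.exp_le_one_iff]
    have e : (-Real.pi ^ 2 * ‖x - y‖ ^ 2 / b m : ℂ) =
        ((-(Real.pi ^ 2 * ‖x - y‖ ^ 2) : ℝ) : ℂ) * (b m)⁻¹ := by push_cast; ring
    rw [e, Complex.re_ofReal_mul, Complex.inv_re]
    have := hbre m
    have := Complex.normSq_nonneg (b m)
    exact mul_nonpos_of_nonpos_of_nonneg (by simp; positivity) (by positivity)
  have hS : Continuous (Function.uncurry fun x y : Rn n =>
      Complex.exp (Complex.I * (‖x - y‖ : ℂ) ^ 2 / (4 * (τ : ℂ)))) := by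
    unfold Function.uncurry; fun_prop
  have hL : Tendsto (fun m => ((Real.pi : ℂ) / b m) ^ ((n : ℂ) / 2) *
      ∫ p : Rn n × Rn n, Complex.exp (-Real.pi ^ 2 * ‖p.1 - p.2‖ ^ 2 / b m) * f p.2 * conj (h p.1))
      atTop (𝓝 ((4 * Real.pi * Complex.I * (τ : ℂ)) ^ (-(n : ℂ) / 2) *
        ∫ p : Rn n × Rn n, Complex.exp (Complex.I * (‖p.1 - p.2‖ : ℂ) ^ 2 / (4 * (τ : ℂ))) *
          f p.2 * conj (h p.1))) := by
    have hval : (Real.pi : ℂ) / (4 * Real.pi ^ 2 * τ * Complex.I) =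
        (4 * Real.pi * Complex.I * τ)⁻¹ := by
      field_simp
    have hre : (4 * Real.pi * Complex.I * (τ : ℂ)) = ((4 * Real.pi * τ : ℝ) : ℂ) * Complex.I := by
      push_cast; ring
    have him : (4 * Real.pi * Complex.I * (τ : ℂ)).im ≠ 0 := by
      rw [hre, Complex.im_ofReal_mul]
      simp [Real.pi_ne_zero, hτ]
    refine Tendsto.mul ?_ ?_
    · have h1 : Tendsto (fun m => (Real.pi : ℂ) / b m) atTop
          (𝓝 ((4 * Real.pi * Complex.I * τ)⁻¹)) := by
        rw [← hval]
        exact tendsto_const_nhds.div hblim hlimne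
      have h2 : (4 * Real.pi * Complex.I * (τ : ℂ))⁻¹ ∈ Complex.slitPlane := by
        refine Or.inr ?_
        rw [Complex.inv_im]
        refine div_ne_zero (neg_ne_zero.2 him) ?_
        rw [Ne, Complex.normSq_eq_zero]
        intro h0
        rw [h0] at him
        simp at him
      have h3 := h1.cpow (tendsto_const_nhds (x := (n : ℂ) / 2)) h2
      rw [Complex.inv_cpow, ← Complex.cpow_neg, ← neg_div] at h3
      · exact h3
      · rw [Ne, Complex.arg_eq_pi_iff]
        exact fun h0 => him h0.2
    · refine tendsto_integral_of_dominated_convergence (fun p => ‖h p.1‖ * ‖f p.2‖) (fun m => ?_) ?_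
        (fun m => ae_of_all _ fun p => ?_) (ae_of_all _ fun p => ?_)
      · exact (integrable_kernel_mul hf hh (hK m) (hK1 m)).aestronglyMeasurable
      · exact hh.norm.mul_prod hf.norm
      · rw [norm_mul, norm_mul, RCLike.norm_conj, mul_comm ‖h p.1‖]
        gcongr
        exact mul_le_of_le_one_left (norm_nonneg _) (hK1 m _ _)
      · refine Tendsto.mul_const _ (Tendsto.mul_const _ ((Complex.continuous_exp.tendsto _).comp ?_))
        have e : Complex.I * (‖p.1 - p.2‖ : ℂ) ^ 2 / (4 * (τ : ℂ)) =
            -Real.pi ^ 2 * ‖p.1 - p.2‖ ^ 2 / (4 * Real.pi ^ 2 * τ * Complex.I) := by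
          have hI := Complex.I_sq
          field_simp
          rw [hI]
          ring
        rw [e]
        exact tendsto_const_nhds.div hblim hlimne
  have hid : ∀ m, ∫ ξ : Rn n, Complex.exp (-b m * ‖ξ‖ ^ 2) * (𝓕 f ξ * conj (𝓕 h ξ)) =
      ((Real.pi : ℂ) / b m) ^ ((n : ℂ) / 2) *
      ∫ p : Rn n × Rn n, Complex.exp (-Real.pi ^ 2 * ‖p.1 - p.2‖ ^ 2 / b m) * f p.2 * conj (h p.1) :=
    fun m => by
      rw [integral_gaussian_mul_fourier (hbre m) hf hh, ← integral_kernel_swap hf hh (hK m) (hK1 m)]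
  simp_rw [hid] at hR
  rw [← tendsto_nhds_unique hL hR, Measure.volume_eq_prod, integral_prod _
    (integrable_kernel_mul hf hh hS fun x y => (schrod_kernel_norm τ x y).le), ← integral_const_mul]
  congr 1; ext x
  simp only [schrod, if_neg hτ]
  rw [integral_mul_const, mul_assoc]

end Pairing

section Duality

theorem ENNReal.le_of_sq_le_mul {a b : ℝ≥0∞} (ha : a ≠ ⊤) (h : a ^ 2 ≤ b * a) : a ≤ b := by
  rcases eq_or_ne a 0 with rfl | h0
  · exact zero_le
  · rw [sq] at h
    exact (ENNReal.mul_le_mul_iff_left h0 ha).1 h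

variable {n : ℕ}

/-- The truncation of `u` to the set where both `‖x‖` and `‖u x‖` are at most `N`. -/
noncomputable def truncation (u : Rn n → ℂ) (N : ℕ) : Rn n → ℂ :=
  {x | ‖x‖ ≤ N ∧ ‖u x‖ ≤ N}.indicator u

theorem measurable_truncation {u : Rn n → ℂ} (hu : Measurable u) (N : ℕ) :
    Measurable (truncation u N) :=
  hu.indicator ((measurableSet_le measurable_norm measurable_const).inter
    (measurableSet_le hu.norm measurable_const))

theorem norm_truncation_le (u : Rn n → ℂ) (N : ℕ) (x : Rn n) : ‖truncation u N x‖ ≤ N := by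
  rw [truncation]
  by_cases hx : x ∈ {x | ‖x‖ ≤ N ∧ ‖u x‖ ≤ N}
  · rw [Set.indicator_of_mem hx]; exact hx.2
  · rw [Set.indicator_of_notMem hx]; simp

theorem memLp_truncation {u : Rn n → ℂ} (hu : Measurable u) (N : ℕ) (p : ℝ≥0∞) :
    MemLp (truncation u N) p := by
  have h : truncation u N = (Metric.closedBall (0 : Rn n) N).indicator (truncation u N) := by
    ext x
    by_cases hx : x ∈ Metric.closedBall (0 : Rn n) N
    · rw [Set.indicator_of_mem hx]
    · rw [Set.indicator_of_notMem hx, truncation, Set.indicator_of_notMem]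
      exact fun h => hx (by simpa using h.1)
  rw [h, memLp_indicator_iff_restrict measurableSet_closedBall]
  have : IsFiniteMeasure ((volume : Measure (Rn n)).restrict (Metric.closedBall 0 N)) :=
    ⟨by simpa using measure_closedBall_lt_top⟩
  exact MemLp.of_bound (measurable_truncation hu N).aestronglyMeasurable N
    (ae_of_all _ (norm_truncation_le u N))

theorem tendsto_truncation (u : Rn n → ℂ) (x : Rn n) :
    Tendsto (fun N => truncation u N x) atTop (𝓝 (u x)) := by
  refine tendsto_const_nhds.congr' ?_
  filter_upwards [eventually_ge_atTop (⌈max ‖x‖ ‖u x‖⌉₊)] with N hN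
  have := Nat.ceil_le.1 hN
  rw [truncation, Set.indicator_of_mem]
  exact ⟨(le_max_left _ _).trans this, (le_max_right _ _).trans this⟩

theorem enorm_integral_mul_conj_le {α : Type*} [MeasurableSpace α] {μ : Measure α} {f h : α → ℂ}
    (hf : AEMeasurable f μ) (hh : AEMeasurable h μ) :
    ‖∫ x, f x * conj (h x) ∂μ‖ₑ ≤ eLpNorm f 2 μ * eLpNorm h 2 μ := by
  refine (enorm_integral_le_lintegral_enorm _).trans ?_
  simp only [enorm_mul, RCLike.enorm_conj, eLpNorm_two_eq]
  exact lintegral_mul_le_rpow_half hf.enorm hh.enorm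

theorem enorm_integral_mul_conj_self {α : Type*} [MeasurableSpace α] {μ : Measure α} {f : α → ℂ}
    (hf : MemLp f 2 μ) : ‖∫ x, f x * conj (f x) ∂μ‖ₑ = eLpNorm f 2 μ ^ 2 := by
  simp_rw [Complex.mul_conj, Complex.normSq_eq_norm_sq]
  rw [integral_complex_ofReal, ← ofReal_norm, Complex.norm_real, Real.norm_of_nonneg
    (integral_nonneg fun x => by positivity), ofReal_integral_eq_lintegral_ofReal
    ((memLp_two_iff_integrable_sq_norm hf.1).1 hf) (ae_of_all _ fun x => by positivity),
    eLpNorm_two_sq]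
  refine lintegral_congr fun x => ?_
  rw [ENNReal.ofReal_pow (norm_nonneg _), ofReal_norm]

theorem enorm_integral_truncation {u : Rn n → ℂ} (hu : Measurable u) (N : ℕ) :
    ‖∫ x, u x * conj (truncation u N x)‖ₑ = eLpNorm (truncation u N) 2 volume ^ 2 := by
  rw [← enorm_integral_mul_conj_self (memLp_truncation hu N 2)]
  refine congrArg _ (integral_congr_ae (ae_of_all _ fun x => ?_))
  dsimp only
  rw [truncation]
  by_cases hx : x ∈ {x | ‖x‖ ≤ N ∧ ‖u x‖ ≤ N} <;> simp [Set.indicator, hx]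

/-- A function whose pairings with nice functions are bounded by the `L²` norm of the latter
is itself in `L²`. -/
theorem eLpNorm_two_le_of_pairing {u : Rn n → ℂ} (hu : Measurable u) {A : ℝ≥0∞}
    (H : ∀ h : Rn n → ℂ, Measurable h → Integrable h → MemLp h 2 →
      ‖∫ x, u x * conj (h x)‖ₑ ≤ A * eLpNorm h 2 volume) :
    eLpNorm u 2 volume ≤ A := by
  have h1 : ∀ N, eLpNorm (truncation u N) 2 volume ≤ A := fun N => by
    refine ENNReal.le_of_sq_le_mul (memLp_truncation hu N 2).eLpNorm_ne_top ?_
    rw [← enorm_integral_truncation hu N]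
    exact H _ (measurable_truncation hu N)
      (memLp_one_iff_integrable.1 (memLp_truncation hu N 1)) (memLp_truncation hu N 2)
  rw [← ENNReal.pow_le_pow_left_iff two_ne_zero, eLpNorm_two_sq]
  refine lintegral_le_of_tendsto (u := fun N x => ‖truncation u N x‖ₑ ^ 2)
    (fun N => ((measurable_truncation hu N).enorm.pow_const 2).aemeasurable)
    (ae_of_all _ fun x => ((ENNReal.continuous_pow 2).tendsto _).comp
      ((continuous_enorm.tendsto _).comp (tendsto_truncation u x))) fun N => ?_
  rw [← eLpNorm_two_sq]
  exact pow_le_pow_left' (h1 N) 2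

end Duality

section Schrod
variable {n : ℕ}

theorem measurable_schrod {α : Type*} [MeasurableSpace α] {f : α → Rn n → ℂ} {τ : α → ℝ}
    (hf : Measurable (Function.uncurry f)) (hτ : Measurable τ) :
    Measurable fun p : α × Rn n => schrod n (τ p.1) (f p.1) p.2 := by
  unfold schrod
  refine Measurable.ite (measurableSet_eq_fun (hτ.comp measurable_fst) measurable_const) hf ?_
  refine Measurable.mul (Measurable.pow_const (by fun_prop) _) ?_
  refine (StronglyMeasurable.integral_prod_right (f := fun (p : α × Rn n) (y : Rn n) =>
    Complex.exp (Complex.I * (‖p.2 - y‖ : ℂ) ^ 2 / (4 * (τ p.1 : ℂ))) * f p.1 y)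
    (Measurable.stronglyMeasurable ?_)).measurable
  have : Measurable fun p : (α × Rn n) × Rn n => f p.1.1 p.2 :=
    hf.comp (measurable_fst.fst.prodMk measurable_snd)
  fun_prop

theorem measurable_schrod_const {f : Rn n → ℂ} (hf : Measurable f) (τ : ℝ) :
    Measurable (schrod n τ f) := by
  have hu : Measurable (Function.uncurry fun _ : ℝ => f) := hf.comp measurable_snd
  have h := measurable_schrod hu measurable_id
  exact h.comp (measurable_prodMk_left (x := τ))

theorem enorm_schrod_le {τ : ℝ} (hτ : τ ≠ 0) (f : Rn n → ℂ) (x : Rn n) :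
    ‖schrod n τ f x‖ₑ ≤ ENNReal.ofReal ((4 * Real.pi * |τ|) ^ (-(n : ℝ) / 2)) *
      eLpNorm f 1 volume := by
  rw [schrod, if_neg hτ, enorm_mul]
  gcongr
  · rw [← ofReal_norm]
    apply le_of_eq
    congr 1
    have : (-(n : ℂ) / 2) = ((-(n : ℝ) / 2 : ℝ) : ℂ) := by push_cast; ring
    rw [this, Complex.norm_cpow_real]
    simp [abs_of_pos Real.pi_pos]
  · refine (enorm_integral_le_lintegral_enorm _).trans ?_
    rw [eLpNorm_one_eq_lintegral_enorm]
    refine lintegral_mono fun y => ?_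
    rw [enorm_mul, ← ofReal_norm, schrod_kernel_norm]
    simp

theorem enorm_schrod_pairing_le {τ : ℝ} (hτ : τ ≠ 0) (f : Rn n → ℂ) {h : Rn n → ℂ}
    (hh : AEStronglyMeasurable h) :
    ‖∫ x, schrod n τ f x * conj (h x)‖ₑ ≤
      ENNReal.ofReal ((4 * Real.pi * |τ|) ^ (-(n : ℝ) / 2)) *
        eLpNorm f 1 volume * eLpNorm h 1 volume := by
  refine (enorm_integral_le_lintegral_enorm _).trans ?_
  rw [eLpNorm_one_eq_lintegral_enorm (f := h), ← lintegral_const_mul'' _ hh.enorm]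
  refine lintegral_mono fun x => ?_
  rw [enorm_mul, RCLike.enorm_conj]
  gcongr
  exact enorm_schrod_le hτ f x

theorem enorm_phase (r : ℝ) : ‖Complex.exp ((r : ℂ) * Complex.I)‖ₑ = 1 := by
  rw [← ofReal_norm, Complex.norm_exp_ofReal_mul_I, ENNReal.ofReal_one]

theorem eLpNorm_schrod_le {τ : ℝ} {f : Rn n → ℂ} (hfm : Measurable f)
    (hf : Integrable f) (hf2 : MemLp f 2) :
    eLpNorm (schrod n τ f) 2 volume ≤ eLpNorm f 2 volume := by
  rcases eq_or_ne τ 0 with rfl | hτ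
  · refine le_of_eq (congrArg (eLpNorm · 2 volume) ?_)
    ext x
    rw [schrod, if_pos rfl]
  have hm : Measurable (schrod n τ f) := measurable_schrod_const hfm τ
  refine eLpNorm_two_le_of_pairing hm fun h hhm hh hh2 => ?_
  rw [integral_schrod_mul_conj hτ hf hf2 hh hh2]
  refine (enorm_integral_le_lintegral_enorm _).trans ?_
  have e : ∀ ξ, ‖Complex.exp (-((4 * Real.pi ^ 2 * τ * ‖ξ‖ ^ 2 : ℝ) : ℂ) * Complex.I) *
      (𝓕 f ξ * conj (𝓕 h ξ))‖ₑ = ‖𝓕 f ξ‖ₑ * ‖𝓕 h ξ‖ₑ := fun ξ => by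
    rw [enorm_mul, ← Complex.ofReal_neg, enorm_phase, one_mul, enorm_mul, RCLike.enorm_conj]
  simp_rw [e]
  refine (lintegral_mul_le_rpow_half
    (continuous_fourier_of_integrable hf).measurable.enorm.aemeasurable
    (continuous_fourier_of_integrable hh).measurable.enorm.aemeasurable).trans ?_
  rw [← eLpNorm_two_eq, ← eLpNorm_two_eq]
  gcongr
  · exact eLpNorm_fourier_le hf
  · exact eLpNorm_fourier_le hh
end Schrod

section Source

variable {n : ℕ}

/-- Space-time functions for which the superposition of all the free evolutions of the time slices
makes sense pointwise on the Fourier side. -/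
structure IsSource (f : ℝ → Rn n → ℂ) : Prop where
  measurable : Measurable (Function.uncurry f)
  one_ne_top : ∀ t, eLpNorm (f t) 1 volume ≠ ⊤
  two_ne_top : ∀ t, eLpNorm (f t) 2 volume ≠ ⊤
  lintegral_one_ne_top : ∫⁻ t, eLpNorm (f t) 1 volume ≠ ⊤
  lintegral_two_ne_top : ∫⁻ t, eLpNorm (f t) 2 volume ≠ ⊤

/-- The Fourier transform of the time slice `f s`, evolved back to time zero. -/
noncomputable def evolved (f : ℝ → Rn n → ℂ) (s : ℝ) (ξ : Rn n) : ℂ :=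
  Complex.exp (((4 * Real.pi ^ 2 * s * ‖ξ‖ ^ 2 : ℝ) : ℂ) * Complex.I) * 𝓕 (f s) ξ

/-- The superposition of all the `evolved f s`. -/
noncomputable def superpose (f : ℝ → Rn n → ℂ) (ξ : Rn n) : ℂ := ∫ s, evolved f s ξ

/-- The pairing of `evolved f s` and `evolved h t`. -/
noncomputable def slicePairing (f h : ℝ → Rn n → ℂ) (s t : ℝ) : ℂ :=
  ∫ ξ, evolved f s ξ * conj (evolved h t ξ)

theorem measurable_eLpNorm_one {f : ℝ → Rn n → ℂ} (hf : Measurable (Function.uncurry f)) :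
    Measurable fun t => eLpNorm (f t) 1 volume := by
  simp only [eLpNorm_one_eq_lintegral_enorm]
  exact Measurable.lintegral_prod_right hf.enorm

theorem measurable_eLpNorm_two {f : ℝ → Rn n → ℂ} (hf : Measurable (Function.uncurry f)) :
    Measurable fun t => eLpNorm (f t) 2 volume := by
  simp only [eLpNorm_two_eq]
  exact (Measurable.lintegral_prod_right (hf.enorm.pow_const 2)).pow_const _

theorem measurable_slice {f : ℝ → Rn n → ℂ} (hf : Measurable (Function.uncurry f)) (t : ℝ) :
    Measurable (f t) :=
  hf.comp measurable_prodMk_left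

theorem measurable_evolved {f : ℝ → Rn n → ℂ} (hf : Measurable (Function.uncurry f)) :
    Measurable (Function.uncurry (evolved f)) := by
  unfold evolved Function.uncurry
  refine Measurable.mul (by fun_prop) ?_
  simp only [Real.fourier_eq]
  refine (StronglyMeasurable.integral_prod_right (f := fun (p : ℝ × Rn n) (v : Rn n) =>
    Real.fourierChar (-(inner ℝ v p.2)) • f p.1 v) (Measurable.stronglyMeasurable ?_)).measurable
  have h1 : Measurable fun p : (ℝ × Rn n) × Rn n => f p.1.1 p.2 :=
    hf.comp (measurable_fst.fst.prodMk measurable_snd)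
  simp only [Circle.smul_def, Real.fourierChar_apply, smul_eq_mul]
  fun_prop

namespace IsSource

variable {f h : ℝ → Rn n → ℂ}

theorem mono (hf : IsSource f) (hh : Measurable (Function.uncurry h))
    (hle : ∀ t x, ‖h t x‖ ≤ ‖f t x‖) : IsSource h := by
  have h1 : ∀ p t, eLpNorm (h t) p volume ≤ eLpNorm (f t) p volume :=
    fun p t => eLpNorm_mono (hle t)
  exact ⟨hh, fun t => ne_top_of_le_ne_top (hf.one_ne_top t) (h1 1 t),
    fun t => ne_top_of_le_ne_top (hf.two_ne_top t) (h1 2 t),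
    ne_top_of_le_ne_top hf.lintegral_one_ne_top (lintegral_mono (h1 1)),
    ne_top_of_le_ne_top hf.lintegral_two_ne_top (lintegral_mono (h1 2))⟩

theorem indicator (hf : IsSource f) {I : Set ℝ} (hI : MeasurableSet I) :
    IsSource (I.indicator f) := by
  refine hf.mono ?_ fun t x => ?_
  · have : Function.uncurry (I.indicator f) = (I ×ˢ Set.univ).indicator (Function.uncurry f) := by
      ext ⟨t, x⟩
      by_cases ht : t ∈ I <;> simp [Function.uncurry, ht]
    rw [this]
    exact hf.measurable.indicator (hI.prod MeasurableSet.univ)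
  · by_cases ht : t ∈ I <;> simp [ht]

theorem integrable (hf : IsSource f) (t : ℝ) : Integrable (f t) :=
  memLp_one_iff_integrable.1
    ⟨(measurable_slice hf.measurable t).aestronglyMeasurable, (hf.one_ne_top t).lt_top⟩

theorem memLp (hf : IsSource f) (t : ℝ) : MemLp (f t) 2 :=
  ⟨(measurable_slice hf.measurable t).aestronglyMeasurable, (hf.two_ne_top t).lt_top⟩

theorem eLpNorm_evolved_le (hf : IsSource f) (s : ℝ) :
    eLpNorm (evolved f s) 2 volume ≤ eLpNorm (f s) 2 volume := by
  refine (eLpNorm_mono_enorm fun ξ => ?_).trans (eLpNorm_fourier_le (hf.integrable s))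
  rw [evolved, enorm_mul, enorm_phase, one_mul]

theorem enorm_evolved_le (f : ℝ → Rn n → ℂ) (s : ℝ) (ξ : Rn n) :
    ‖evolved f s ξ‖ₑ ≤ eLpNorm (f s) 1 volume := by
  rw [evolved, enorm_mul, enorm_phase, one_mul, eLpNorm_one_eq_lintegral_enorm, Real.fourier_eq]
  refine (enorm_integral_le_lintegral_enorm _).trans (lintegral_mono fun v => ?_)
  rw [← ofReal_norm, Circle.norm_smul, ofReal_norm]

theorem integrable_evolved (hf : IsSource f) (ξ : Rn n) : Integrable fun s => evolved f s ξ :=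
  ⟨((measurable_evolved hf.measurable).comp measurable_prodMk_right).aestronglyMeasurable,
    (lintegral_mono fun s => enorm_evolved_le f s ξ).trans_lt hf.lintegral_one_ne_top.lt_top⟩

theorem measurable_superpose (hf : Measurable (Function.uncurry f)) : Measurable (superpose f) :=
  (StronglyMeasurable.integral_prod_left (f := evolved f)
    (measurable_evolved hf).stronglyMeasurable).measurable

theorem lintegral_enorm_evolved_mul_le (hf : IsSource f) {c : Rn n → ℂ} (hc : AEMeasurable c) (s : ℝ) :
    ∫⁻ ξ, ‖evolved f s ξ‖ₑ * ‖c ξ‖ₑ ≤ eLpNorm (f s) 2 volume * eLpNorm c 2 volume := by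
  refine (lintegral_mul_le_rpow_half
    (measurable_slice (measurable_evolved hf.measurable) s).enorm.aemeasurable hc.enorm).trans ?_
  rw [← eLpNorm_two_eq, ← eLpNorm_two_eq]
  gcongr
  exact hf.eLpNorm_evolved_le s

theorem eLpNorm_superpose_le (hf : IsSource f) :
    eLpNorm (superpose f) 2 volume ≤ ∫⁻ s, eLpNorm (f s) 2 volume := by
  refine eLpNorm_two_le_of_pairing (measurable_superpose hf.measurable) fun h hh _ _ => ?_
  calc ‖∫ ξ, superpose f ξ * conj (h ξ)‖ₑ
      ≤ ∫⁻ ξ, ∫⁻ s, ‖evolved f s ξ‖ₑ * ‖h ξ‖ₑ := by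
        refine (enorm_integral_le_lintegral_enorm _).trans (lintegral_mono fun ξ => ?_)
        rw [enorm_mul, RCLike.enorm_conj, lintegral_mul_const]
        · gcongr
          exact enorm_integral_le_lintegral_enorm _
        · exact ((measurable_evolved hf.measurable).comp measurable_prodMk_right).enorm
    _ = ∫⁻ s, ∫⁻ ξ, ‖evolved f s ξ‖ₑ * ‖h ξ‖ₑ := by
        refine lintegral_lintegral_swap (Measurable.aemeasurable ?_)
        exact ((measurable_evolved hf.measurable).comp measurable_swap).enorm.mul
          (hh.comp measurable_fst).enorm
    _ ≤ ∫⁻ s, eLpNorm (f s) 2 volume * eLpNorm h 2 volume :=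
        lintegral_mono fun s => hf.lintegral_enorm_evolved_mul_le hh.aemeasurable s
    _ = _ := lintegral_mul_const _ (measurable_eLpNorm_two hf.measurable)

theorem eLpNorm_superpose_ne_top (hf : IsSource f) : eLpNorm (superpose f) 2 volume ≠ ⊤ :=
  ne_top_of_le_ne_top hf.lintegral_two_ne_top hf.eLpNorm_superpose_le

theorem measurable_evolved_mul_conj (hf : IsSource f) (hh : IsSource h) :
    Measurable fun p : (ℝ × ℝ) × Rn n => evolved f p.1.1 p.2 * conj (evolved h p.1.2 p.2) :=
  ((measurable_evolved hf.measurable).comp (measurable_fst.fst.prodMk measurable_snd)).mul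
    (Complex.continuous_conj.measurable.comp
      ((measurable_evolved hh.measurable).comp (measurable_fst.snd.prodMk measurable_snd)))

theorem enorm_slicePairing_le (hf : IsSource f) (hh : IsSource h) (s t : ℝ) :
    ‖slicePairing f h s t‖ₑ ≤ eLpNorm (f s) 2 volume * eLpNorm (h t) 2 volume := by
  refine (enorm_integral_mul_conj_le
    (measurable_slice (measurable_evolved hf.measurable) s).aemeasurable
    (measurable_slice (measurable_evolved hh.measurable) t).aemeasurable).trans ?_
  gcongr
  · exact hf.eLpNorm_evolved_le s
  · exact hh.eLpNorm_evolved_le t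

theorem slicePairing_eq (hf : IsSource f) {s t : ℝ} (hst : t - s ≠ 0) (hh : Integrable (h t))
    (hh2 : MemLp (h t) 2) :
    slicePairing f h s t = ∫ x, schrod n (t - s) (f s) x * conj (h t x) := by
  rw [integral_schrod_mul_conj hst (hf.integrable s) (hf.memLp s) hh hh2,
    slicePairing]
  refine integral_congr_ae (ae_of_all _ fun ξ => ?_)
  have : Complex.exp (-((4 * Real.pi ^ 2 * (t - s) * ‖ξ‖ ^ 2 : ℝ) : ℂ) * Complex.I) =
      Complex.exp (((4 * Real.pi ^ 2 * s * ‖ξ‖ ^ 2 : ℝ) : ℂ) * Complex.I) *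
        conj (Complex.exp (((4 * Real.pi ^ 2 * t * ‖ξ‖ ^ 2 : ℝ) : ℂ) * Complex.I)) := by
    rw [← Complex.exp_conj, ← Complex.exp_add, map_mul, Complex.conj_I, Complex.conj_ofReal]
    push_cast; ring_nf
  simp only [evolved, map_mul]
  rw [this]; ring

theorem enorm_slicePairing_le_of_ne (hf : IsSource f) (hh : IsSource h) {s t : ℝ}
    (hst : t - s ≠ 0) :
    ‖slicePairing f h s t‖ₑ ≤ ENNReal.ofReal ((4 * Real.pi * |t - s|) ^ (-(n : ℝ) / 2)) *
      eLpNorm (f s) 1 volume * eLpNorm (h t) 1 volume := by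
  rw [slicePairing_eq hf hst (hh.integrable t) (hh.memLp t)]
  exact enorm_schrod_pairing_le hst _ (hh.integrable t).aestronglyMeasurable

theorem integrable_evolved_mul_conj (hf : IsSource f) (hh : IsSource h) :
    Integrable (fun p : (ℝ × ℝ) × Rn n => evolved f p.1.1 p.2 * conj (evolved h p.1.2 p.2))
      ((volume.prod volume).prod volume) := by
  have hm := measurable_evolved_mul_conj hf hh
  refine ⟨hm.aestronglyMeasurable, ?_⟩
  rw [HasFiniteIntegral, lintegral_prod _ hm.enorm.aemeasurable]
  calc _ ≤ ∫⁻ p : ℝ × ℝ, eLpNorm (f p.1) 2 volume * eLpNorm (h p.2) 2 volume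
        ∂(volume.prod volume) := by
        refine lintegral_mono fun p => ?_
        simp only [enorm_mul, RCLike.enorm_conj]
        refine (hf.lintegral_enorm_evolved_mul_le
          (measurable_slice (measurable_evolved hh.measurable) p.2).aemeasurable p.1).trans ?_
        gcongr
        exact hh.eLpNorm_evolved_le _
    _ = (∫⁻ s, eLpNorm (f s) 2 volume) * ∫⁻ t, eLpNorm (h t) 2 volume :=
        lintegral_prod_mul (measurable_eLpNorm_two hf.measurable).aemeasurable
          (measurable_eLpNorm_two hh.measurable).aemeasurable
    _ < ⊤ := ENNReal.mul_lt_top hf.lintegral_two_ne_top.lt_top hh.lintegral_two_ne_top.lt_top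

theorem integrable_slicePairing (hf : IsSource f) (hh : IsSource h) :
    Integrable (fun p : ℝ × ℝ => slicePairing f h p.1 p.2) :=
  (integrable_evolved_mul_conj hf hh).integral_prod_left

theorem integral_superpose_mul_conj (hf : IsSource f) (hh : IsSource h) :
    ∫ ξ, superpose f ξ * conj (superpose h ξ) = ∫ p : ℝ × ℝ, slicePairing f h p.1 p.2 := by
  have := integral_integral_swap
    (f := fun (p : ℝ × ℝ) (ξ : Rn n) => evolved f p.1 ξ * conj (evolved h p.2 ξ))
    (integrable_evolved_mul_conj hf hh)
  rw [Measure.volume_eq_prod]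
  refine Eq.trans ?_ this.symm
  refine integral_congr_ae (ae_of_all _ fun ξ => ?_)
  dsimp only
  rw [integral_prod_mul (fun s => evolved f s ξ) (fun t => conj (evolved h t ξ)), integral_conj]
  rfl

end IsSource

theorem evolved_indicator (f : ℝ → Rn n → ℂ) (I : Set ℝ) :
    evolved (I.indicator f) = I.indicator (evolved f) := by
  ext s ξ
  by_cases hs : s ∈ I
  · simp [evolved, hs]
  · simp [evolved, hs, Real.fourier_eq]

theorem slicePairing_indicator (f h : ℝ → Rn n → ℂ) (I J : Set ℝ) :
    (fun p : ℝ × ℝ => slicePairing (I.indicator f) (J.indicator h) p.1 p.2) =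
      (I ×ˢ J).indicator fun p => slicePairing f h p.1 p.2 := by
  ext ⟨s, t⟩
  simp only [slicePairing, evolved_indicator]
  by_cases hs : s ∈ I <;> by_cases ht : t ∈ J <;> simp [hs, ht]

end Source

section Duhamel

variable {n : ℕ} {f h : ℝ → Rn n → ℂ}

/-- The superposition of the free evolutions of all the time slices of `f`. -/
noncomputable def duhamel (f : ℝ → Rn n → ℂ) (t : ℝ) (x : Rn n) : ℂ :=
  ∫ s, schrod n (t - s) (f s) x

theorem measurable_schrod_sub (hf : Measurable (Function.uncurry f)) :
    Measurable fun p : (ℝ × Rn n) × ℝ => schrod n (p.1.1 - p.2) (f p.2) p.1.2 := by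
  have hu : Measurable (Function.uncurry fun q : ℝ × ℝ => f q.2) :=
    hf.comp (measurable_fst.snd.prodMk measurable_snd)
  have h := measurable_schrod (τ := fun q : ℝ × ℝ => q.1 - q.2) hu
    (measurable_fst.sub measurable_snd)
  exact h.comp ((measurable_fst.fst.prodMk measurable_snd).prodMk measurable_fst.snd)

theorem measurable_duhamel (hf : Measurable (Function.uncurry f)) :
    Measurable (Function.uncurry (duhamel f)) :=
  (StronglyMeasurable.integral_prod_right (f := fun (p : ℝ × Rn n) (s : ℝ) =>
    schrod n (p.1 - s) (f s) p.2) (measurable_schrod_sub hf).stronglyMeasurable).measurable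

theorem enorm_evolved_eq (h : ℝ → Rn n → ℂ) (t : ℝ) (ξ : Rn n) :
    ‖evolved h t ξ‖ₑ = ‖𝓕 (h t) ξ‖ₑ := by
  rw [evolved, enorm_mul, enorm_phase, one_mul]

namespace IsSource

theorem integrable_schrod_mul_conj (hf : IsSource f) (t : ℝ) {c : Rn n → ℂ} (hc : Measurable c)
    (hc2 : MemLp c 2) :
    Integrable (fun p : Rn n × ℝ => schrod n (t - p.2) (f p.2) p.1 * conj (c p.1))
      (volume.prod volume) := by
  have h1 : Measurable fun p : Rn n × ℝ => schrod n (t - p.2) (f p.2) p.1 :=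
    (measurable_schrod_sub hf.measurable).comp
      ((measurable_const.prodMk measurable_fst).prodMk measurable_snd)
  have hm : Measurable fun p : Rn n × ℝ => schrod n (t - p.2) (f p.2) p.1 * conj (c p.1) :=
    h1.mul (Complex.continuous_conj.measurable.comp (hc.comp measurable_fst))
  refine ⟨hm.aestronglyMeasurable, ?_⟩
  rw [HasFiniteIntegral, lintegral_prod_symm _ hm.enorm.aemeasurable]
  simp only [enorm_mul, RCLike.enorm_conj]
  calc _ ≤ ∫⁻ s, eLpNorm (f s) 2 volume * eLpNorm c 2 volume := by
        refine lintegral_mono fun s => ?_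
        refine (lintegral_mul_le_rpow_half
          (measurable_schrod_const (measurable_slice hf.measurable s) (t - s)).enorm.aemeasurable
          hc.enorm.aemeasurable).trans ?_
        rw [← eLpNorm_two_eq, ← eLpNorm_two_eq]
        gcongr
        exact eLpNorm_schrod_le (measurable_slice hf.measurable s) (hf.integrable s) (hf.memLp s)
    _ = (∫⁻ s, eLpNorm (f s) 2 volume) * eLpNorm c 2 volume :=
        lintegral_mul_const _ (measurable_eLpNorm_two hf.measurable)
    _ < ⊤ := ENNReal.mul_lt_top hf.lintegral_two_ne_top.lt_top hc2.eLpNorm_lt_top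

theorem integrable_evolved_mul_conj_slice (hf : IsSource f) {c : Rn n → ℂ} (hc : Measurable c)
    (hc2 : eLpNorm c 2 volume ≠ ⊤) :
    Integrable (fun p : ℝ × Rn n => evolved f p.1 p.2 * conj (c p.2))
      (volume.prod volume) := by
  have h1 := measurable_evolved hf.measurable
  have hm : Measurable fun p : ℝ × Rn n => evolved f p.1 p.2 * conj (c p.2) :=
    h1.mul (Complex.continuous_conj.measurable.comp (hc.comp measurable_snd))
  refine ⟨hm.aestronglyMeasurable, ?_⟩
  rw [HasFiniteIntegral, lintegral_prod _ hm.enorm.aemeasurable]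
  simp only [enorm_mul, RCLike.enorm_conj]
  calc _ ≤ ∫⁻ s, eLpNorm (f s) 2 volume * eLpNorm c 2 volume :=
        lintegral_mono fun s => hf.lintegral_enorm_evolved_mul_le hc.aemeasurable s
    _ = (∫⁻ s, eLpNorm (f s) 2 volume) * eLpNorm c 2 volume :=
        lintegral_mul_const _ (measurable_eLpNorm_two hf.measurable)
    _ < ⊤ := ENNReal.mul_lt_top hf.lintegral_two_ne_top.lt_top hc2.lt_top

theorem integral_duhamel_mul_conj (hf : IsSource f) (hhm : Measurable (Function.uncurry h)) {t : ℝ}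
    (hh : Integrable (h t)) (hh2 : MemLp (h t) 2) :
    ∫ x, duhamel f t x * conj (h t x) = ∫ ξ, superpose f ξ * conj (evolved h t ξ) := by
  have he2 : eLpNorm (evolved h t) 2 volume ≠ ⊤ := by
    refine ne_top_of_le_ne_top hh2.eLpNorm_ne_top
      ((eLpNorm_mono_enorm fun ξ => ?_).trans (eLpNorm_fourier_le hh))
    rw [enorm_evolved_eq]
  have h1 := integral_integral_swap
    (f := fun (x : Rn n) (s : ℝ) => schrod n (t - s) (f s) x * conj (h t x))
    (hf.integrable_schrod_mul_conj t (measurable_slice hhm t) hh2)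
  have h2 := integral_integral_swap
    (f := fun (s : ℝ) (ξ : Rn n) => evolved f s ξ * conj (evolved h t ξ))
    (hf.integrable_evolved_mul_conj_slice (measurable_slice (measurable_evolved hhm) t) he2)
  simp only [integral_mul_const] at h1 h2
  refine h1.trans (Eq.trans (integral_congr_ae ?_) h2)
  have : ∀ᵐ s : ℝ, s ≠ t := by simp [ae_iff]
  filter_upwards [this] with s hs
  exact (slicePairing_eq hf (sub_ne_zero.2 hs.symm) hh hh2).symm

theorem eLpNorm_duhamel_le (hf : IsSource f) (t : ℝ) :
    eLpNorm (duhamel f t) 2 volume ≤ eLpNorm (superpose f) 2 volume := by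
  refine eLpNorm_two_le_of_pairing (measurable_slice (measurable_duhamel hf.measurable) t)
    fun c hc hc1 hc2 => ?_
  have hcm : Measurable (Function.uncurry fun _ : ℝ => c) := hc.comp measurable_snd
  rw [hf.integral_duhamel_mul_conj (h := fun _ => c) hcm hc1 hc2]
  refine (enorm_integral_mul_conj_le (measurable_superpose hf.measurable).aemeasurable
    (measurable_slice (measurable_evolved hcm) t).aemeasurable).trans ?_
  gcongr
  refine (eLpNorm_mono_enorm fun ξ => ?_).trans (eLpNorm_fourier_le hc1)
  rw [enorm_evolved_eq]

theorem integral_integral_duhamel_mul_conj (hf : IsSource f) (hh : IsSource h) :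
    ∫ t, ∫ x, duhamel f t x * conj (h t x) = ∫ ξ, superpose f ξ * conj (superpose h ξ) := by
  simp only [fun t => hf.integral_duhamel_mul_conj hh.measurable (hh.integrable t) (hh.memLp t)]
  have h1 := hh.integrable_evolved_mul_conj_slice (measurable_superpose hf.measurable)
    hf.eLpNorm_superpose_ne_top
  have h2 : Integrable (fun p : ℝ × Rn n => superpose f p.2 * conj (evolved h p.1 p.2))
      (volume.prod volume) := by
    refine h1.congr' (Measurable.aestronglyMeasurable ?_) (ae_of_all _ fun p => ?_)
    · exact ((measurable_superpose hf.measurable).comp measurable_snd).mul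
        (Complex.continuous_conj.measurable.comp (measurable_evolved hh.measurable))
    · simp [mul_comm]
  rw [integral_integral_swap (f := fun (t : ℝ) (ξ : Rn n) => superpose f ξ * conj (evolved h t ξ)) h2]
  refine integral_congr_ae (ae_of_all _ fun ξ => ?_)
  dsimp only
  rw [integral_const_mul, integral_conj]
  rfl

theorem enorm_integral_integral_duhamel_mul_conj_le (hf : IsSource f) (hh : IsSource h) :
    ‖∫ t, ∫ x, duhamel f t x * conj (h t x)‖ₑ ≤
      eLpNorm (superpose f) 2 volume * eLpNorm (superpose h) 2 volume := by
  rw [hf.integral_integral_duhamel_mul_conj hh]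
  exact enorm_integral_mul_conj_le (measurable_superpose hf.measurable).aemeasurable
    (measurable_superpose hh.measurable).aemeasurable

end IsSource

end Duhamel

section Kernel

/-- The kernel `|τ|^(-3/2)`, cut off to `|τ| ≥ a`. -/
noncomputable def tailKernel (a τ : ℝ) : ℝ≥0∞ :=
  {τ : ℝ | a ≤ |τ|}.indicator (fun τ => ENNReal.ofReal (|τ| ^ (-(3 : ℝ) / 2))) τ

theorem measurable_tailKernel (a : ℝ) : Measurable (tailKernel a) :=
  Measurable.indicator (by fun_prop) (measurableSet_le measurable_const measurable_id.abs)

theorem lintegral_tailKernel_le {a : ℝ} (ha : 0 < a) :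
    ∫⁻ τ, tailKernel a τ ≤ ENNReal.ofReal (4 * a ^ (-(1 : ℝ) / 2)) := by
  set k : ℝ → ℝ≥0∞ := (Set.Ioi a).indicator fun τ => ENNReal.ofReal (τ ^ (-(3 : ℝ) / 2)) with hk
  have hkm : Measurable k := Measurable.indicator (by fun_prop) measurableSet_Ioi
  have hint : ∫⁻ τ, k τ = ENNReal.ofReal (2 * a ^ (-(1 : ℝ) / 2)) := by
    rw [hk, lintegral_indicator measurableSet_Ioi, ← ofReal_integral_eq_lintegral_ofReal
      (integrableOn_Ioi_rpow_of_lt (by norm_num) ha)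
      ((ae_restrict_mem measurableSet_Ioi).mono fun τ hτ => Real.rpow_nonneg (ha.le.trans hτ.le) _),
      integral_Ioi_rpow_of_lt (by norm_num) ha]
    congr 1
    norm_num
    ring
  have hne : ∀ᵐ τ : ℝ, |τ| ≠ a := by
    have h1 : ∀ᵐ τ : ℝ, τ ≠ a := by simp [ae_iff]
    have h2 : ∀ᵐ τ : ℝ, τ ≠ -a := by simp [ae_iff]
    filter_upwards [h1, h2] with τ h3 h4 h5
    rcases abs_choice τ with h | h <;> rw [h] at h5
    · exact h3 h5
    · exact h4 (by linarith)
  calc ∫⁻ τ, tailKernel a τ ≤ ∫⁻ τ, (k τ + k (-τ)) := by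
        refine lintegral_mono_ae (hne.mono fun τ hτ => ?_)
        by_cases h : a ≤ |τ|
        · have h' : a < |τ| := lt_of_le_of_ne h hτ.symm
          rw [tailKernel, Set.indicator_of_mem (show τ ∈ {τ | a ≤ |τ|} from h)]
          rcases abs_choice τ with h1 | h1 <;> rw [h1] at h' ⊢
          · exact le_add_right (by rw [hk, Set.indicator_of_mem (Set.mem_Ioi.2 h')])
          · exact le_add_left (by rw [hk, Set.indicator_of_mem (Set.mem_Ioi.2 h')])
        · rw [tailKernel, Set.indicator_of_notMem (show τ ∉ {τ | a ≤ |τ|} from h)]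
          exact zero_le
    _ = ENNReal.ofReal (4 * a ^ (-(1 : ℝ) / 2)) := by
        rw [lintegral_add_left hkm, lintegral_neg_eq_self, hint, ← ENNReal.ofReal_add
          (by positivity) (by positivity)]
        ring_nf

/-- The kernel `min (x⁻¹) (x^(1/2) |τ|^(-3/2))`, up to a constant. -/
noncomputable def atomKernel (x τ : ℝ) : ℝ≥0∞ :=
  (Set.Icc (-x) x).indicator (fun _ => ENNReal.ofReal x⁻¹) τ +
    ENNReal.ofReal (x ^ (1 / 2 : ℝ)) * tailKernel x τ

theorem measurable_atomKernel (x : ℝ) : Measurable (atomKernel x) :=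
  (measurable_const.indicator measurableSet_Icc).add ((measurable_tailKernel x).const_mul _)

theorem lintegral_atomKernel_le {x : ℝ} (hx : 0 < x) : ∫⁻ τ, atomKernel x τ ≤ 6 := by
  unfold atomKernel
  rw [lintegral_add_left (measurable_const.indicator measurableSet_Icc),
    lintegral_const_mul _ (measurable_tailKernel x), lintegral_indicator_const measurableSet_Icc,
    Real.volume_Icc, ← ENNReal.ofReal_mul (by positivity)]
  have h1 : x⁻¹ * (x - -x) = 2 := by field_simp; ring
  have h2 : x ^ (1 / 2 : ℝ) * (4 * x ^ (-(1 : ℝ) / 2)) = 4 := by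
    have : x ^ (1 / 2 : ℝ) * x ^ (-(1 : ℝ) / 2) = 1 := by
      rw [← Real.rpow_add hx]; norm_num
    linear_combination 4 * this
  rw [h1]
  calc _ ≤ ENNReal.ofReal 2 + ENNReal.ofReal (x ^ (1 / 2 : ℝ)) *
        ENNReal.ofReal (4 * x ^ (-(1 : ℝ) / 2)) := by
        gcongr
        exact lintegral_tailKernel_le hx
    _ = 6 := by
        rw [← ENNReal.ofReal_mul (by positivity), h2, ← ENNReal.ofReal_add (by norm_num)
          (by norm_num)]
        norm_num

end Kernel

section Atom

variable {n : ℕ}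

/-- The slice `f s` is of size `c s` in `L²`, after multiplication by `ρ`, and behaves as if it
were carried by a set of measure `ρ ^ n`. -/
structure IsSliceAtom (f : ℝ → Rn n → ℂ) (ρ : ℝ) (c : ℝ → ℝ≥0∞) : Prop where
  pos : 0 < ρ
  source : IsSource f
  measurable : Measurable c
  two_le : ∀ s, eLpNorm (f s) 2 volume ≤ ENNReal.ofReal ρ⁻¹ * c s
  one_le : ∀ s, eLpNorm (f s) 1 volume ≤ ENNReal.ofReal (ρ ^ ((n : ℝ) / 2 - 1)) * c s

variable {f h : ℝ → Rn n → ℂ} {ρ σ : ℝ} {c d : ℝ → ℝ≥0∞}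

theorem rpow_mul_rpow_le_of_le (hn : 3 ≤ n) {x r : ℝ} (hx : 0 < x) (hxr : x ≤ r) :
    (4 * Real.pi * r) ^ (-(n : ℝ) / 2) * x ^ ((n : ℝ) / 2 - 1) ≤
      x ^ (1 / 2 : ℝ) * r ^ (-(3 : ℝ) / 2) := by
  have hr : 0 < r := hx.trans_le hxr
  have hn' : (3 : ℝ) ≤ n := by exact_mod_cast hn
  have h1 : (4 * Real.pi * r) ^ (-(n : ℝ) / 2) ≤ r ^ (-(n : ℝ) / 2) := by
    refine Real.rpow_le_rpow_of_nonpos hr ?_ (by linarith)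
    nlinarith [Real.pi_gt_three]
  calc _ ≤ r ^ (-(n : ℝ) / 2) * x ^ ((n : ℝ) / 2 - 1) := by gcongr
    _ = r ^ (-(3 : ℝ) / 2) * r ^ (((3 : ℝ) - n) / 2) * (x ^ (((n : ℝ) - 3) / 2) * x ^ (1 / 2 : ℝ)) := by
        rw [← Real.rpow_add hr, ← Real.rpow_add hx]
        ring_nf
    _ ≤ r ^ (-(3 : ℝ) / 2) * r ^ (((3 : ℝ) - n) / 2) * (r ^ (((n : ℝ) - 3) / 2) * x ^ (1 / 2 : ℝ)) := by
        gcongr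
    _ = _ := by
        have : r ^ (((3 : ℝ) - n) / 2) * r ^ (((n : ℝ) - 3) / 2) = 1 := by
          rw [← Real.rpow_add hr]
          ring_nf
          exact Real.rpow_zero r
        linear_combination r ^ (-(3 : ℝ) / 2) * x ^ (1 / 2 : ℝ) * this

theorem inv_le_rpow_mul_rpow {x r : ℝ} (hr : 0 < r) (hrx : r ≤ x) :
    x⁻¹ ≤ x ^ (1 / 2 : ℝ) * r ^ (-(3 : ℝ) / 2) := by
  have hx : 0 < x := hr.trans_le hrx
  calc x⁻¹ = x ^ (1 / 2 : ℝ) * x ^ (-(3 : ℝ) / 2) := by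
        rw [← Real.rpow_add hx, ← Real.rpow_neg_one]; norm_num
    _ ≤ _ := by
        gcongr 1
        exact Real.rpow_le_rpow_of_nonpos hr hrx (by norm_num)

namespace IsSliceAtom

theorem indicator (hf : IsSliceAtom f ρ c) {I : Set ℝ} (hI : MeasurableSet I) :
    IsSliceAtom (I.indicator f) ρ (I.indicator c) where
  pos := hf.pos
  source := hf.source.indicator hI
  measurable := hf.measurable.indicator hI
  two_le s := by
    by_cases hs : s ∈ I
    · simpa [hs] using hf.two_le s
    · simp [hs]
  one_le s := by
    by_cases hs : s ∈ I
    · simpa [hs] using hf.one_le s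
    · simp [hs]

theorem enorm_slicePairing_le (hf : IsSliceAtom f ρ c) (hh : IsSliceAtom h σ d) (s t : ℝ) :
    ‖slicePairing f h s t‖ₑ ≤ ENNReal.ofReal (ρ * σ)⁻¹ * (c s * d t) := by
  refine (hf.source.enorm_slicePairing_le hh.source s t).trans
    ((mul_le_mul' (hf.two_le s) (hh.two_le t)).trans_eq ?_)
  rw [mul_inv, ENNReal.ofReal_mul (inv_nonneg.2 hf.pos.le)]
  ring

theorem enorm_slicePairing_le_of_ne (hn : 3 ≤ n) (hf : IsSliceAtom f ρ c) (hh : IsSliceAtom h σ d) {s t : ℝ}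
    (hst : t - s ≠ 0) :
    ‖slicePairing f h s t‖ₑ ≤ ENNReal.ofReal ((ρ * σ) ^ (1 / 2 : ℝ) * |t - s| ^ (-(3 : ℝ) / 2)) *
      (c s * d t) := by
  have hx : 0 < ρ * σ := mul_pos hf.pos hh.pos
  rcases le_total (ρ * σ) |t - s| with hle | hle
  · refine (hf.source.enorm_slicePairing_le_of_ne hh.source hst).trans
      ((mul_le_mul' (mul_le_mul_right (hf.one_le s) _) (hh.one_le t)).trans ?_)
    calc _ = ENNReal.ofReal ((4 * Real.pi * |t - s|) ^ (-(n : ℝ) / 2) *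
          (ρ * σ) ^ ((n : ℝ) / 2 - 1)) * (c s * d t) := by
          rw [Real.mul_rpow hf.pos.le hh.pos.le, ENNReal.ofReal_mul (by positivity),
            ENNReal.ofReal_mul (Real.rpow_nonneg hf.pos.le _)]
          ring
      _ ≤ _ := by
          gcongr ENNReal.ofReal ?_ * _
          exact rpow_mul_rpow_le_of_le hn hx hle
  · refine (hf.enorm_slicePairing_le hh s t).trans ?_
    gcongr
    exact inv_le_rpow_mul_rpow (abs_pos.2 hst) hle

theorem enorm_slicePairing_le_tailKernel (hn : 3 ≤ n) (hf : IsSliceAtom f ρ c) (hh : IsSliceAtom h σ d)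
    {s t a : ℝ} (ha : 0 < a) (hst : a ≤ |t - s|) :
    ‖slicePairing f h s t‖ₑ ≤ ENNReal.ofReal ((ρ * σ) ^ (1 / 2 : ℝ)) * tailKernel a (t - s) *
      (c s * d t) := by
  have hx : 0 < ρ * σ := mul_pos hf.pos hh.pos
  rw [tailKernel, Set.indicator_of_mem (show t - s ∈ {τ | a ≤ |τ|} from hst),
    ← ENNReal.ofReal_mul (by positivity)]
  exact hf.enorm_slicePairing_le_of_ne hn hh (abs_pos.1 (ha.trans_le hst))

theorem enorm_slicePairing_le_atomKernel (hn : 3 ≤ n) (hf : IsSliceAtom f ρ c) (hh : IsSliceAtom h σ d)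
    (s t : ℝ) :
    ‖slicePairing f h s t‖ₑ ≤ atomKernel (ρ * σ) (t - s) * (c s * d t) := by
  have hx : 0 < ρ * σ := mul_pos hf.pos hh.pos
  rcases le_total |t - s| (ρ * σ) with hle | hle
  · refine (hf.enorm_slicePairing_le hh s t).trans ?_
    gcongr
    rw [atomKernel, Set.indicator_of_mem (Set.mem_Icc.2 (abs_le.1 hle))]
    exact le_self_add
  · refine (hf.enorm_slicePairing_le_tailKernel hn hh hx hle).trans ?_
    gcongr
    exact le_add_self

theorem lintegral_kernel_mul_le (hf : IsSliceAtom f ρ c) (hh : IsSliceAtom h σ d) {k : ℝ → ℝ≥0∞}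
    (hk : Measurable k) :
    ∫⁻ p : ℝ × ℝ, k (p.2 - p.1) * (c p.1 * d p.2) ≤
      (∫⁻ τ, k τ) * ((∫⁻ s, c s ^ 2) ^ (1 / 2 : ℝ) * (∫⁻ t, d t ^ 2) ^ (1 / 2 : ℝ)) := by
  refine le_trans (le_of_eq ?_) (_root_.lintegral_kernel_mul_le hk hf.measurable hh.measurable)
  rw [Measure.volume_eq_prod, lintegral_prod _ (Measurable.aemeasurable ?_)]
  · simp only [mul_assoc]
  · exact (hk.comp (measurable_snd.sub measurable_fst)).mul
      ((hf.measurable.comp measurable_fst).mul (hh.measurable.comp measurable_snd))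

theorem eLpNorm_superpose_sq_le (hn : 3 ≤ n) (hf : IsSliceAtom f ρ c) :
    eLpNorm (superpose f) 2 volume ^ 2 ≤ 6 * ∫⁻ s, c s ^ 2 := by
  have hm : MemLp (superpose f) 2 :=
    ⟨(IsSource.measurable_superpose hf.source.measurable).aestronglyMeasurable,
      hf.source.eLpNorm_superpose_ne_top.lt_top⟩
  rw [← enorm_integral_mul_conj_self hm, hf.source.integral_superpose_mul_conj hf.source]
  calc _ ≤ ∫⁻ p : ℝ × ℝ, ‖slicePairing f f p.1 p.2‖ₑ := enorm_integral_le_lintegral_enorm _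
    _ ≤ ∫⁻ p : ℝ × ℝ, atomKernel (ρ * ρ) (p.2 - p.1) * (c p.1 * c p.2) :=
        lintegral_mono fun p => hf.enorm_slicePairing_le_atomKernel hn hf p.1 p.2
    _ ≤ _ := hf.lintegral_kernel_mul_le hf (measurable_atomKernel _)
    _ ≤ _ := by
        rw [ENNReal.rpow_half_mul_self]
        gcongr
        exact lintegral_atomKernel_le (mul_pos hf.pos hf.pos)

end IsSliceAtom

end Atom

section Block

/-- The `m`-th time interval of length `T`. -/
def timeBlock (T : ℝ) (m : ℤ) : Set ℝ := {t | ⌊t / T⌋ = m}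

/-- The `m`-th time interval of length `T` together with its two neighbours. -/
def wideBlock (T : ℝ) (m : ℤ) : Set ℝ := {t | |⌊t / T⌋ - m| ≤ 1}

theorem measurable_floor_div (T : ℝ) : Measurable fun t : ℝ => ⌊t / T⌋ :=
  Int.measurable_floor.comp (measurable_id.div_const T)

theorem measurableSet_timeBlock (T : ℝ) (m : ℤ) : MeasurableSet (timeBlock T m) :=
  measurable_floor_div T (measurableSet_singleton m)

theorem measurableSet_wideBlock (T : ℝ) (m : ℤ) : MeasurableSet (wideBlock T m) :=
  measurable_floor_div T (MeasurableSet.of_discrete (s := {k : ℤ | |k - m| ≤ 1}))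

theorem volume_wideBlock_le {T : ℝ} (hT : 0 < T) (m : ℤ) :
    volume (wideBlock T m) ≤ ENNReal.ofReal (3 * T) := by
  have : wideBlock T m ⊆ Set.Icc ((m - 1) * T) ((m + 2) * T) := fun t ht => by
    have h1 := abs_le.1 (show |⌊t / T⌋ - m| ≤ 1 from ht)
    have h2 : ((m - 1 : ℤ) : ℝ) ≤ t / T := Int.le_floor.1 (by linarith)
    have h3 : t / T < ((m + 2 : ℤ) : ℝ) := Int.floor_lt.1 (by linarith)
    push_cast at h2 h3
    exact ⟨(le_div_iff₀ hT).1 h2, ((div_lt_iff₀ hT).1 h3).le⟩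
  refine (measure_mono this).trans ?_
  rw [Real.volume_Icc]
  gcongr
  linarith

theorem tsum_setLIntegral_timeBlock (T : ℝ) (f : ℝ → ℝ≥0∞) :
    ∑' m, ∫⁻ t in timeBlock T m, f t = ∫⁻ t, f t := by
  rw [← lintegral_iUnion (measurableSet_timeBlock T)]
  · rw [show ⋃ m, timeBlock T m = Set.univ by ext t; simp [timeBlock], setLIntegral_univ]
  · intro m k hmk
    exact Set.disjoint_left.2 fun t h1 h2 => hmk (Eq.trans (Eq.symm h1) h2)

theorem tsum_setLIntegral_wideBlock_le (T : ℝ) {f : ℝ → ℝ≥0∞} (hf : Measurable f) :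
    ∑' m, ∫⁻ t in wideBlock T m, f t ≤ 3 * ∫⁻ t, f t := by
  simp only [← lintegral_indicator (measurableSet_wideBlock T _)]
  rw [← lintegral_tsum fun m => (hf.indicator (measurableSet_wideBlock T m)).aemeasurable,
    ← lintegral_const_mul _ hf]
  refine lintegral_mono fun t => ?_
  rw [tsum_eq_sum (s := Finset.Icc (⌊t / T⌋ - 1) (⌊t / T⌋ + 1))]
  · refine (Finset.sum_le_card_nsmul _ _ (f t) fun m _ => Set.indicator_le_self _ _ _).trans ?_
    rw [Int.card_Icc, nsmul_eq_mul]
    have : (⌊t / T⌋ + 1 + 1 - (⌊t / T⌋ - 1)).toNat = 3 := by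
      rw [show ⌊t / T⌋ + 1 + 1 - (⌊t / T⌋ - 1) = 3 by ring]; rfl
    rw [this]; rfl
  · intro m hm
    refine Set.indicator_of_notMem (fun h => hm ?_) _
    have h1 := abs_le.1 (show |⌊t / T⌋ - m| ≤ 1 from h)
    exact Finset.mem_Icc.2 ⟨by linarith, by linarith⟩

theorem tsum_rpow_half_mul_le {ι : Type*} (a b : ι → ℝ≥0∞) :
    ∑' i, a i ^ (1 / 2 : ℝ) * b i ^ (1 / 2 : ℝ) ≤
      (∑' i, a i) ^ (1 / 2 : ℝ) * (∑' i, b i) ^ (1 / 2 : ℝ) := by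
  let _ : MeasurableSpace ι := ⊤
  have := lintegral_mul_le_rpow_half (μ := Measure.count)
    (c := fun i => a i ^ (1 / 2 : ℝ)) (d := fun i => b i ^ (1 / 2 : ℝ))
    measurable_from_top.aemeasurable measurable_from_top.aemeasurable
  simpa only [ENNReal.rpow_half_sq, lintegral_count] using this

theorem setLIntegral_le_rpow_half (s : Set ℝ) {d : ℝ → ℝ≥0∞} (hd : Measurable d) :
    ∫⁻ t in s, d t ≤ (∫⁻ t in s, d t ^ 2) ^ (1 / 2 : ℝ) * volume s ^ (1 / 2 : ℝ) := by
  have := lintegral_mul_le_rpow_half (μ := volume.restrict s) hd.aemeasurable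
    (measurable_const (a := (1 : ℝ≥0∞))).aemeasurable
  simpa using this

/-- The pairs of times in the same time interval of length `T` or in neighbouring ones. -/
def nearPairs (T : ℝ) : Set (ℝ × ℝ) := ⋃ m, timeBlock T m ×ˢ wideBlock T m

theorem measurableSet_nearPairs (T : ℝ) : MeasurableSet (nearPairs T) :=
  MeasurableSet.iUnion fun m => (measurableSet_timeBlock T m).prod (measurableSet_wideBlock T m)

theorem le_abs_sub_of_notMem_nearPairs {T : ℝ} (hT : 0 < T) {p : ℝ × ℝ} (hp : p ∉ nearPairs T) :
    T ≤ |p.2 - p.1| := by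
  by_contra! h
  refine hp (Set.mem_iUnion.2 ⟨⌊p.1 / T⌋, rfl, ?_⟩)
  have h1 : |p.2 / T - p.1 / T| < 1 := by
    rw [← sub_div, abs_div, abs_of_pos hT, div_lt_one hT]; exact h
  have h2 := abs_lt.1 h1
  have h3 := Int.floor_le (p.1 / T)
  have h4 := Int.lt_floor_add_one (p.1 / T)
  change |⌊p.2 / T⌋ - ⌊p.1 / T⌋| ≤ 1
  refine abs_le.2 ⟨?_, ?_⟩
  · have : ⌊p.1 / T⌋ - 1 ≤ ⌊p.2 / T⌋ := Int.le_floor.2 (by push_cast; linarith)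
    linarith
  · have : ⌊p.2 / T⌋ < ⌊p.1 / T⌋ + 2 := Int.floor_lt.2 (by push_cast; linarith)
    linarith

end Block

section AlmostOrthogonality

variable {n : ℕ} {f h : ℝ → Rn n → ℂ} {ρ σ : ℝ} {c d : ℝ → ℝ≥0∞}

namespace IsSliceAtom

theorem eLpNorm_superpose_indicator_le (hn : 3 ≤ n) (hf : IsSliceAtom f ρ c) {I : Set ℝ}
    (hI : MeasurableSet I) :
    eLpNorm (superpose (I.indicator f)) 2 volume ≤
      6 ^ (1 / 2 : ℝ) * (∫⁻ s in I, c s ^ 2) ^ (1 / 2 : ℝ) := by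
  rw [← ENNReal.mul_rpow_of_nonneg _ _ (by norm_num), ← ENNReal.pow_le_pow_left_iff two_ne_zero,
    ENNReal.rpow_half_sq]
  refine ((hf.indicator hI).eLpNorm_superpose_sq_le hn).trans_eq ?_
  rw [← lintegral_indicator hI]
  congr 1
  refine lintegral_congr fun s => ?_
  by_cases hs : s ∈ I <;> simp [hs]

theorem eLpNorm_superpose_indicator_le' (hf : IsSliceAtom f ρ c) {I : Set ℝ}
    (hI : MeasurableSet I) :
    eLpNorm (superpose (I.indicator f)) 2 volume ≤
      ENNReal.ofReal ρ⁻¹ * ((∫⁻ s in I, c s ^ 2) ^ (1 / 2 : ℝ) * volume I ^ (1 / 2 : ℝ)) := by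
  refine (hf.source.indicator hI).eLpNorm_superpose_le.trans ?_
  calc _ ≤ ∫⁻ s, ENNReal.ofReal ρ⁻¹ * I.indicator c s :=
        lintegral_mono fun s => (hf.indicator hI).two_le s
    _ = ENNReal.ofReal ρ⁻¹ * ∫⁻ s in I, c s := by
        rw [lintegral_const_mul _ (hf.measurable.indicator hI), lintegral_indicator hI]
    _ ≤ _ := by
        gcongr
        exact setLIntegral_le_rpow_half I hf.measurable

theorem enorm_setIntegral_block_le (hn : 3 ≤ n) (hf : IsSliceAtom f ρ c) (hh : IsSliceAtom h σ d)
    {T : ℝ} (hT : 0 < T) (m : ℤ) :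
    ‖∫ p in timeBlock T m ×ˢ wideBlock T m, slicePairing f h p.1 p.2‖ₑ ≤
      6 ^ (1 / 2 : ℝ) * ENNReal.ofReal σ⁻¹ * ENNReal.ofReal (3 * T) ^ (1 / 2 : ℝ) *
        ((∫⁻ s in timeBlock T m, c s ^ 2) ^ (1 / 2 : ℝ) *
          (∫⁻ s in wideBlock T m, d s ^ 2) ^ (1 / 2 : ℝ)) := by
  have hI := measurableSet_timeBlock T m
  have hJ := measurableSet_wideBlock T m
  rw [← integral_indicator (hI.prod hJ), ← slicePairing_indicator,
    ← (hf.source.indicator hI).integral_superpose_mul_conj (hh.source.indicator hJ)]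
  refine (enorm_integral_mul_conj_le
    (IsSource.measurable_superpose (hf.source.indicator hI).measurable).aemeasurable
    (IsSource.measurable_superpose (hh.source.indicator hJ).measurable).aemeasurable).trans ?_
  refine (mul_le_mul' (hf.eLpNorm_superpose_indicator_le hn hI)
    ((hh.eLpNorm_superpose_indicator_le' hJ).trans (mul_le_mul_right (mul_le_mul_right
      (ENNReal.rpow_le_rpow (volume_wideBlock_le hT m) (by norm_num)) _) _))).trans_eq ?_
  ring

theorem enorm_setIntegral_nearPairs_le (hn : 3 ≤ n) (hf : IsSliceAtom f ρ c)
    (hh : IsSliceAtom h σ d) {T : ℝ} (hT : 0 < T) :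
    ‖∫ p in nearPairs T, slicePairing f h p.1 p.2‖ₑ ≤
      ENNReal.ofReal (8 * (σ⁻¹ * T ^ (1 / 2 : ℝ))) *
        ((∫⁻ s, c s ^ 2) ^ (1 / 2 : ℝ) * (∫⁻ t, d t ^ 2) ^ (1 / 2 : ℝ)) := by
  rw [nearPairs, integral_iUnion
    (fun m => (measurableSet_timeBlock T m).prod (measurableSet_wideBlock T m))]
  rotate_left
  · intro m k hmk
    exact Set.disjoint_left.2 fun t h1 h2 => hmk (Eq.trans (Eq.symm h1.1) h2.1)
  · exact (hf.source.integrable_slicePairing hh.source).integrableOn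
  refine enorm_tsum_le_tsum_enorm.trans
    ((ENNReal.tsum_le_tsum fun m => hf.enorm_setIntegral_block_le hn hh hT m).trans ?_)
  rw [ENNReal.tsum_mul_left]
  calc _ ≤ 6 ^ (1 / 2 : ℝ) * ENNReal.ofReal σ⁻¹ * ENNReal.ofReal (3 * T) ^ (1 / 2 : ℝ) *
        ((∫⁻ s, c s ^ 2) ^ (1 / 2 : ℝ) * (3 * ∫⁻ t, d t ^ 2) ^ (1 / 2 : ℝ)) := by
        gcongr
        refine (tsum_rpow_half_mul_le _ _).trans ?_
        rw [tsum_setLIntegral_timeBlock]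
        gcongr
        exact tsum_setLIntegral_wideBlock_le T (hh.measurable.pow_const 2)
    _ = (6 * ENNReal.ofReal (3 * T) * 3) ^ (1 / 2 : ℝ) * ENNReal.ofReal σ⁻¹ *
        ((∫⁻ s, c s ^ 2) ^ (1 / 2 : ℝ) * (∫⁻ t, d t ^ 2) ^ (1 / 2 : ℝ)) := by
        simp only [ENNReal.mul_rpow_of_nonneg _ _ (show (0 : ℝ) ≤ 1 / 2 by norm_num)]
        ring
    _ ≤ _ := by
        gcongr
        have e : (6 : ℝ≥0∞) * ENNReal.ofReal (3 * T) * 3 = ENNReal.ofReal (54 * T) := by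
          rw [show (6 : ℝ≥0∞) = ENNReal.ofReal 6 by norm_num,
            show (3 : ℝ≥0∞) = ENNReal.ofReal 3 by norm_num, ← ENNReal.ofReal_mul (by norm_num),
            ← ENNReal.ofReal_mul (by positivity)]
          ring_nf
        rw [e, ENNReal.ofReal_rpow_of_nonneg (by positivity) (by norm_num),
          ← ENNReal.ofReal_mul (by positivity), ← Real.sqrt_eq_rpow, ← Real.sqrt_eq_rpow]
        refine ENNReal.ofReal_le_ofReal ?_
        have : √(54 * T) ≤ 8 * √T := by
          refine Real.sqrt_le_iff.2 ⟨by positivity, ?_⟩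
          rw [mul_pow, Real.sq_sqrt hT.le]; linarith
        calc _ ≤ 8 * √T * σ⁻¹ := by
              gcongr
              exact inv_nonneg.2 hh.pos.le
          _ = _ := by ring

theorem enorm_setIntegral_compl_nearPairs_le (hn : 3 ≤ n) (hf : IsSliceAtom f ρ c)
    (hh : IsSliceAtom h σ d) {T : ℝ} (hT : 0 < T) :
    ‖∫ p in (nearPairs T)ᶜ, slicePairing f h p.1 p.2‖ₑ ≤
      ENNReal.ofReal (4 * ((ρ * σ) ^ (1 / 2 : ℝ) * T ^ (-(1 : ℝ) / 2))) *
        ((∫⁻ s, c s ^ 2) ^ (1 / 2 : ℝ) * (∫⁻ t, d t ^ 2) ^ (1 / 2 : ℝ)) := by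
  calc _ ≤ ∫⁻ p in (nearPairs T)ᶜ, ‖slicePairing f h p.1 p.2‖ₑ :=
        enorm_integral_le_lintegral_enorm _
    _ ≤ ∫⁻ p in (nearPairs T)ᶜ, ENNReal.ofReal ((ρ * σ) ^ (1 / 2 : ℝ)) *
        tailKernel T (p.2 - p.1) * (c p.1 * d p.2) :=
        setLIntegral_mono' (measurableSet_nearPairs T).compl fun p hp =>
          hf.enorm_slicePairing_le_tailKernel hn hh hT (le_abs_sub_of_notMem_nearPairs hT hp)
    _ ≤ _ := setLIntegral_le_lintegral _ _
    _ ≤ _ := hf.lintegral_kernel_mul_le hh ((measurable_tailKernel T).const_mul _)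
    _ ≤ _ := by
        rw [lintegral_const_mul _ (measurable_tailKernel T)]
        gcongr
        calc _ ≤ ENNReal.ofReal ((ρ * σ) ^ (1 / 2 : ℝ)) * ENNReal.ofReal (4 * T ^ (-(1 : ℝ) / 2)) := by
              gcongr
              exact lintegral_tailKernel_le hT
          _ = _ := by
              rw [← ENNReal.ofReal_mul (Real.rpow_nonneg (mul_pos hf.pos hh.pos).le _)]
              ring_nf

/-- Superpositions of atoms carried by different spatial scales are almost orthogonal. -/
theorem enorm_integral_superpose_mul_conj_le (hn : 3 ≤ n) (hf : IsSliceAtom f ρ c)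
    (hh : IsSliceAtom h σ d) :
    ‖∫ ξ, superpose f ξ * conj (superpose h ξ)‖ₑ ≤ ENNReal.ofReal (12 * (ρ / σ) ^ (1 / 4 : ℝ)) *
      ((∫⁻ s, c s ^ 2) ^ (1 / 2 : ℝ) * (∫⁻ t, d t ^ 2) ^ (1 / 2 : ℝ)) := by
  have hρ := hf.pos
  have hσ := hh.pos
  set T := σ ^ (3 / 2 : ℝ) * ρ ^ (1 / 2 : ℝ) with hTdef
  have hT : 0 < T := by positivity
  have hq : (ρ / σ) ^ (1 / 4 : ℝ) = ρ ^ (1 / 4 : ℝ) * σ ^ (-(1 / 4 : ℝ)) := by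
    rw [Real.div_rpow hρ.le hσ.le, Real.rpow_neg hσ.le, div_eq_mul_inv]
  have hpow : ∀ a : ℝ, T ^ a = σ ^ (3 / 2 * a) * ρ ^ (1 / 2 * a) := fun a => by
    rw [hTdef, Real.mul_rpow (by positivity) (by positivity), ← Real.rpow_mul hσ.le,
      ← Real.rpow_mul hρ.le]
  have h1 : σ⁻¹ * T ^ (1 / 2 : ℝ) = (ρ / σ) ^ (1 / 4 : ℝ) := by
    rw [hq, hpow, ← mul_assoc, ← Real.rpow_neg_one, ← Real.rpow_add hσ, mul_comm]
    congr 2 <;> norm_num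
  have h2 : (ρ * σ) ^ (1 / 2 : ℝ) * T ^ (-(1 : ℝ) / 2) = (ρ / σ) ^ (1 / 4 : ℝ) := by
    rw [hq, hpow, Real.mul_rpow hρ.le hσ.le, mul_comm (σ ^ _) (ρ ^ _), mul_mul_mul_comm,
      ← Real.rpow_add hρ, ← Real.rpow_add hσ]
    congr 2 <;> norm_num
  rw [hf.source.integral_superpose_mul_conj hh.source, ← integral_add_compl
    (measurableSet_nearPairs T) (hf.source.integrable_slicePairing hh.source)]
  refine (enorm_add_le _ _).trans ((add_le_add (hf.enorm_setIntegral_nearPairs_le hn hh hT)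
    (hf.enorm_setIntegral_compl_nearPairs_le hn hh hT)).trans_eq ?_)
  rw [h1, h2, ← add_mul, ← ENNReal.ofReal_add (by positivity) (by positivity)]
  ring_nf

end IsSliceAtom

end AlmostOrthogonality

section Dyadic

/-- The dyadic interval `[2^k, 2^(k+1))`. -/
def dyadic (k : ℤ) : Set ℝ := Set.Ico (2 ^ k) (2 ^ (k + 1))

theorem sum_dyadic_indicator {β : Type*} [AddCommMonoid β] {K : ℕ} {r : ℝ}
    (hr : r ∈ Set.Ico ((2 : ℝ) ^ (-(K : ℤ))) (2 ^ (K : ℤ))) (b : β) :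
    ∑ k ∈ Finset.Ico (-(K : ℤ)) K, (dyadic k).indicator (fun _ => b) r = b := by
  have hr0 : 0 < r := lt_of_lt_of_le (by positivity) hr.1
  obtain ⟨k, hk⟩ := exists_mem_Ico_zpow hr0 one_lt_two
  rw [Finset.sum_eq_single k]
  · exact Set.indicator_of_mem (s := dyadic k) hk _
  · intro j _ hjk
    refine Set.indicator_of_notMem (fun hj => hjk ?_) _
    have h1 := (zpow_lt_zpow_iff_right₀ (one_lt_two (α := ℝ))).1 (hj.1.trans_lt hk.2)
    have h2 := (zpow_lt_zpow_iff_right₀ (one_lt_two (α := ℝ))).1 (hk.1.trans_lt hj.2)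
    linarith [Int.lt_add_one_iff.1 h1, Int.lt_add_one_iff.1 h2]
  · intro hkn
    exfalso
    refine hkn (Finset.mem_Ico.2 ⟨?_, ?_⟩)
    · exact Int.lt_add_one_iff.1
        ((zpow_lt_zpow_iff_right₀ (one_lt_two (α := ℝ))).1 (hr.1.trans_lt hk.2))
    · exact (zpow_lt_zpow_iff_right₀ (one_lt_two (α := ℝ))).1 (hk.1.trans_lt hr.2)

/-- The interaction constant of two dyadic scales at distance `m`. -/
noncomputable def dyadicDecay (m : ℤ) : ℝ≥0∞ := ENNReal.ofReal (12 * (2 ^ (-(1 / 4 : ℝ))) ^ m.natAbs)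

theorem tsum_dyadicDecay_ne_top : ∑' m, dyadicDecay m ≠ ⊤ := by
  have h : Summable fun k : ℕ => 12 * ((2 : ℝ) ^ (-(1 / 4 : ℝ))) ^ k :=
    (summable_geometric_of_lt_one (by positivity)
      (Real.rpow_lt_one_of_one_lt_of_neg one_lt_two (by norm_num))).mul_left 12
  have hs : Summable fun m : ℤ => 12 * ((2 : ℝ) ^ (-(1 / 4 : ℝ))) ^ m.natAbs :=
    Summable.of_nat_of_neg (by simpa using h) (by simpa using h)
  exact hs.tsum_ofReal_ne_top

theorem sum_sum_mul_le (s : Finset ℤ) (κ : ℤ → ℝ≥0∞) (hκ : ∀ m, κ (-m) = κ m) (A : ℤ → ℝ≥0∞) :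
    ∑ j ∈ s, ∑ k ∈ s, κ (j - k) * (A j * A k) ≤ 2 * (∑' m, κ m) * ∑ j ∈ s, A j ^ 2 := by
  have h1 : ∀ j, ∑ k ∈ s, κ (j - k) ≤ ∑' m, κ m := fun j =>
    (ENNReal.sum_le_tsum s).trans_eq ((Equiv.subLeft j).tsum_eq κ)
  have h2 : ∀ a b : ℝ≥0∞, a * b ≤ a ^ 2 + b ^ 2 := fun a b => by
    rcases le_total a b with h | h
    · exact le_add_left ((mul_le_mul_left h b).trans_eq (sq b).symm)
    · exact le_add_right ((mul_le_mul_right h a).trans_eq (sq a).symm)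
  calc _ ≤ ∑ j ∈ s, ∑ k ∈ s, (κ (j - k) * A j ^ 2 + κ (j - k) * A k ^ 2) := by
        gcongr with j _ k _
        rw [← mul_add]
        gcongr
        exact h2 _ _
    _ = ∑ j ∈ s, (∑ k ∈ s, κ (j - k)) * A j ^ 2 + ∑ j ∈ s, (∑ k ∈ s, κ (j - k)) * A j ^ 2 := by
        simp only [Finset.sum_add_distrib]
        congr 1
        · simp only [Finset.sum_mul]
        · rw [Finset.sum_comm]
          simp only [Finset.sum_mul]
          refine Finset.sum_congr rfl fun j _ => Finset.sum_congr rfl fun k _ => ?_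
          rw [← hκ (j - k), neg_sub]
    _ ≤ ∑ j ∈ s, (∑' m, κ m) * A j ^ 2 + ∑ j ∈ s, (∑' m, κ m) * A j ^ 2 := by
        gcongr <;> exact h1 _
    _ = _ := by rw [← Finset.mul_sum]; ring

end Dyadic

section Kato

variable {n : ℕ}

theorem eLpNorm_two_le_of_weight {u : Rn n → ℂ} {v : Rn n → ℝ} {a : ℝ} (ha : 0 < a)
    (h : ∀ x, u x ≠ 0 → a ≤ v x) :
    eLpNorm u 2 volume ≤ ENNReal.ofReal a⁻¹ * eLpNorm (fun x => u x * v x) 2 volume := by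
  refine eLpNorm_le_mul_eLpNorm_of_ae_le_mul (ae_of_all _ fun x => ?_) 2
  rcases eq_or_ne (u x) 0 with h0 | h0
  · simp [h0]
  · rw [norm_mul, Complex.norm_real, ← mul_assoc, mul_comm a⁻¹, mul_assoc]
    refine le_mul_of_one_le_right (norm_nonneg _) ?_
    rw [← div_eq_inv_mul, one_le_div ha]
    exact (h x h0).trans (le_abs_self _)

theorem eLpNorm_one_le_of_support {u : Rn n → ℂ} (hu : Measurable u) {S : Set (Rn n)}
    (hS : ∀ x, u x ≠ 0 → x ∈ S) :
    eLpNorm u 1 volume ≤ eLpNorm u 2 volume * volume S ^ (1 / 2 : ℝ) := by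
  set S' := toMeasurable volume S
  have hS' : MeasurableSet S' := measurableSet_toMeasurable _ _
  have h := lintegral_mul_le_rpow_half (μ := volume) hu.enorm.aemeasurable
    ((measurable_const (a := (1 : ℝ≥0∞))).indicator hS').aemeasurable
  have h1 : ∀ x, ‖u x‖ₑ * S'.indicator (fun _ => 1) x = ‖u x‖ₑ := fun x => by
    rcases eq_or_ne (u x) 0 with h0 | h0
    · simp [h0]
    · rw [Set.indicator_of_mem (subset_toMeasurable _ _ (hS x h0)), mul_one]
  have h2 : ∀ x, (S'.indicator (fun _ => (1 : ℝ≥0∞)) x) ^ 2 = S'.indicator (fun _ => 1) x :=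
    fun x => by by_cases hx : x ∈ S' <;> simp [hx]
  simp only [h1, h2] at h
  rw [lintegral_indicator_const hS', one_mul, measure_toMeasurable, ← eLpNorm_two_eq] at h
  rw [eLpNorm_one_eq_lintegral_enorm]
  exact h

theorem evolved_finset_sum {ι : Type*} (s : Finset ι) {f : ι → ℝ → Rn n → ℂ}
    (hf : ∀ i ∈ s, IsSource (f i)) (t : ℝ) (ξ : Rn n) :
    evolved (fun t x => ∑ i ∈ s, f i t x) t ξ = ∑ i ∈ s, evolved (f i) t ξ := by
  simp only [evolved, Real.fourier_eq, Finset.smul_sum]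
  rw [integral_finsetSum, Finset.mul_sum]
  intro i hi
  exact (Real.fourierIntegral_convergent_iff ξ).2 ((hf i hi).integrable t)

theorem superpose_finset_sum {ι : Type*} (s : Finset ι) {f : ι → ℝ → Rn n → ℂ}
    (hf : ∀ i ∈ s, IsSource (f i)) (ξ : Rn n) :
    superpose (fun t x => ∑ i ∈ s, f i t x) ξ = ∑ i ∈ s, superpose (f i) ξ := by
  simp only [superpose, evolved_finset_sum s hf]
  exact integral_finsetSum s fun i hi => (hf i hi).integrable_evolved ξ

end Kato

section Weight

variable {n : ℕ}

/-- The part of `f` on which the weight `y` takes values in the dyadic interval `[2^k, 2^(k+1))`. -/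
noncomputable def dyadicPiece (y : ℝ → Rn n → ℝ) (k : ℤ) (f : ℝ → Rn n → ℂ) (t : ℝ) (x : Rn n) : ℂ :=
  (dyadic k).indicator (fun _ => f t x) (y t x)

/-- The product of `f` with the weight `y`. -/
noncomputable def weighted (y : ℝ → Rn n → ℝ) (f : ℝ → Rn n → ℂ) (t : ℝ) (x : Rn n) : ℂ :=
  f t x * (y t x : ℂ)

/-- A time-dependent weight whose sublevel sets are at most as large as those of `‖x‖`, up to the
constant `M`. -/
structure IsWeight (y : ℝ → Rn n → ℝ) (M : ℝ≥0∞) : Prop where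
  measurable : Measurable (Function.uncurry y)
  ne_top : M ≠ ⊤
  volume_le : ∀ t r, 0 < r → volume {x | 0 < y t x ∧ y t x < r} ≤ M * ENNReal.ofReal (r ^ n)

/-- Functions which are square integrable against the weight `y`, and vanish unless `y` is between
`2 ^ (-K)` and `2 ^ K`. -/
structure IsWeighted (y : ℝ → Rn n → ℝ) (K : ℕ) (f : ℝ → Rn n → ℂ) : Prop where
  measurable : Measurable (Function.uncurry f)
  mem_Ico : ∀ t x, f t x ≠ 0 → y t x ∈ Set.Ico ((2 : ℝ) ^ (-(K : ℤ))) (2 ^ (K : ℤ))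
  ne_top : ∀ t, eLpNorm (weighted y f t) 2 volume ≠ ⊤
  lintegral_ne_top : ∫⁻ t, eLpNorm (weighted y f t) 2 volume ≠ ⊤

/-- The constant relating the `L¹` and the weighted `L²` norms of a dyadic piece. -/
noncomputable def pieceConst (n : ℕ) (M : ℝ≥0∞) : ℝ≥0∞ := 1 + (M * 2 ^ n) ^ (1 / 2 : ℝ)

theorem pieceConst_ne_top (n : ℕ) {M : ℝ≥0∞} (hM : M ≠ ⊤) : pieceConst n M ≠ ⊤ :=
  ENNReal.add_ne_top.2 ⟨ENNReal.one_ne_top, ENNReal.rpow_ne_top_of_nonneg (by norm_num)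
    (ENNReal.mul_ne_top hM (ENNReal.pow_ne_top ENNReal.ofNat_ne_top))⟩

variable {y : ℝ → Rn n → ℝ} {M : ℝ≥0∞} {K : ℕ} {f : ℝ → Rn n → ℂ}

theorem measurable_weighted (hy : Measurable (Function.uncurry y))
    (hf : Measurable (Function.uncurry f)) : Measurable (Function.uncurry (weighted y f)) :=
  hf.mul (Complex.measurable_ofReal.comp hy)

theorem measurable_dyadicPiece (hy : Measurable (Function.uncurry y))
    (hf : Measurable (Function.uncurry f)) (k : ℤ) :
    Measurable (Function.uncurry (dyadicPiece y k f)) :=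
  Measurable.indicator (s := Function.uncurry y ⁻¹' dyadic k) hf (hy measurableSet_Ico)

theorem enorm_dyadicPiece_le (y : ℝ → Rn n → ℝ) (k : ℤ) (f : ℝ → Rn n → ℂ) (t : ℝ) (x : Rn n) :
    ‖dyadicPiece y k f t x‖ ≤ ‖f t x‖ :=
  norm_indicator_le_norm_self (fun _ => f t x) _

theorem mem_dyadic_of_dyadicPiece_ne_zero {k : ℤ} {t : ℝ} {x : Rn n}
    (h : dyadicPiece y k f t x ≠ 0) : y t x ∈ dyadic k :=
  Set.mem_of_indicator_ne_zero h

theorem weighted_dyadicPiece (k : ℤ) (t : ℝ) (x : Rn n) :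
    weighted y (dyadicPiece y k f) t x = (dyadic k).indicator (fun _ => weighted y f t x) (y t x) := by
  by_cases h : y t x ∈ dyadic k <;> simp [weighted, dyadicPiece, h]

namespace IsWeighted

theorem sum_dyadicPiece (hf : IsWeighted y K f) (t : ℝ) (x : Rn n) :
    ∑ k ∈ Finset.Ico (-(K : ℤ)) K, dyadicPiece y k f t x = f t x := by
  rcases eq_or_ne (f t x) 0 with h | h
  · simp [dyadicPiece, h]
  · exact sum_dyadic_indicator (hf.mem_Ico t x h) _

theorem sum_enorm_weighted_sq (hf : IsWeighted y K f) (t : ℝ) (x : Rn n) :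
    ∑ k ∈ Finset.Ico (-(K : ℤ)) K, ‖weighted y (dyadicPiece y k f) t x‖ₑ ^ 2 =
      ‖weighted y f t x‖ₑ ^ 2 := by
  have h1 : ∀ k, ‖weighted y (dyadicPiece y k f) t x‖ₑ ^ 2 =
      (dyadic k).indicator (fun _ => ‖weighted y f t x‖ₑ ^ 2) (y t x) := fun k => by
    rw [weighted_dyadicPiece]
    by_cases h : y t x ∈ dyadic k <;> simp [h]
  simp only [h1]
  rcases eq_or_ne (f t x) 0 with h | h
  · simp [weighted, h]
  · exact sum_dyadic_indicator (hf.mem_Ico t x h) _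

theorem eLpNorm_two_le (hf : IsWeighted y K f) (t : ℝ) :
    eLpNorm (f t) 2 volume ≤
      ENNReal.ofReal ((2 : ℝ) ^ (-(K : ℤ)))⁻¹ * eLpNorm (weighted y f t) 2 volume :=
  eLpNorm_two_le_of_weight (by positivity) fun x hx => (hf.mem_Ico t x hx).1

theorem eLpNorm_one_le (hy : IsWeight y M) (hf : IsWeighted y K f) (t : ℝ) :
    eLpNorm (f t) 1 volume ≤
      ENNReal.ofReal ((2 : ℝ) ^ (-(K : ℤ)))⁻¹ * eLpNorm (weighted y f t) 2 volume *
        (M * ENNReal.ofReal (((2 : ℝ) ^ (K : ℤ)) ^ n)) ^ (1 / 2 : ℝ) := by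
  refine (eLpNorm_one_le_of_support (S := {x | 0 < y t x ∧ y t x < (2 : ℝ) ^ (K : ℤ)})
    (measurable_slice hf.measurable t) fun x hx => ?_).trans ?_
  · have := hf.mem_Ico t x hx
    exact ⟨lt_of_lt_of_le (by positivity) this.1, this.2⟩
  · gcongr
    · exact hf.eLpNorm_two_le t
    · exact hy.volume_le t _ (by positivity)

theorem isSource (hy : IsWeight y M) (hf : IsWeighted y K f) : IsSource f := by
  have hm := measurable_eLpNorm_two (measurable_weighted hy.measurable hf.measurable)
  have hV : (M * ENNReal.ofReal (((2 : ℝ) ^ (K : ℤ)) ^ n)) ^ (1 / 2 : ℝ) ≠ ⊤ :=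
    ENNReal.rpow_ne_top_of_nonneg (by norm_num) (ENNReal.mul_ne_top hy.ne_top ENNReal.ofReal_ne_top)
  refine ⟨hf.measurable, fun t => ?_, fun t => ?_, ?_, ?_⟩
  · exact ne_top_of_le_ne_top (ENNReal.mul_ne_top (ENNReal.mul_ne_top ENNReal.ofReal_ne_top
      (hf.ne_top t)) hV) (hf.eLpNorm_one_le hy t)
  · exact ne_top_of_le_ne_top (ENNReal.mul_ne_top ENNReal.ofReal_ne_top (hf.ne_top t))
      (hf.eLpNorm_two_le t)
  · refine ne_top_of_le_ne_top ?_ (lintegral_mono fun t => hf.eLpNorm_one_le hy t)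
    rw [lintegral_mul_const _ (hm.const_mul _), lintegral_const_mul _ hm]
    exact ENNReal.mul_ne_top (ENNReal.mul_ne_top ENNReal.ofReal_ne_top hf.lintegral_ne_top) hV
  · refine ne_top_of_le_ne_top ?_ (lintegral_mono fun t => hf.eLpNorm_two_le t)
    rw [lintegral_const_mul _ hm]
    exact ENNReal.mul_ne_top ENNReal.ofReal_ne_top hf.lintegral_ne_top

theorem isSource_dyadicPiece (hy : IsWeight y M) (hf : IsWeighted y K f) (k : ℤ) :
    IsSource (dyadicPiece y k f) :=
  (hf.isSource hy).mono (measurable_dyadicPiece hy.measurable hf.measurable k)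
    (enorm_dyadicPiece_le y k f)

theorem isSliceAtom_dyadicPiece (hy : IsWeight y M) (hf : IsWeighted y K f) (k : ℤ) :
    IsSliceAtom (dyadicPiece y k f) (2 ^ k)
      (fun t => pieceConst n M * eLpNorm (weighted y (dyadicPiece y k f) t) 2 volume) := by
  have hpm := measurable_dyadicPiece hy.measurable hf.measurable k
  have h2 : ∀ t, eLpNorm (dyadicPiece y k f t) 2 volume ≤ ENNReal.ofReal ((2 : ℝ) ^ k)⁻¹ *
      eLpNorm (weighted y (dyadicPiece y k f) t) 2 volume := fun t =>
    eLpNorm_two_le_of_weight (by positivity) fun x hx => (mem_dyadic_of_dyadicPiece_ne_zero hx).1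
  refine ⟨by positivity, hf.isSource_dyadicPiece hy k, ?_, fun t => ?_, fun t => ?_⟩
  · exact (measurable_eLpNorm_two (measurable_weighted hy.measurable hpm)).const_mul _
  · refine (h2 t).trans ?_
    gcongr
    exact le_mul_of_one_le_left zero_le le_self_add
  · refine (eLpNorm_one_le_of_support (S := {x | 0 < y t x ∧ y t x < (2 : ℝ) ^ (k + 1)})
      (measurable_slice hpm t) fun x hx => ?_).trans ?_
    · have := mem_dyadic_of_dyadicPiece_ne_zero hx
      exact ⟨lt_of_lt_of_le (by positivity) this.1, this.2⟩
    calc _ ≤ ENNReal.ofReal ((2 : ℝ) ^ k)⁻¹ *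
          eLpNorm (weighted y (dyadicPiece y k f) t) 2 volume *
            (M * ENNReal.ofReal (((2 : ℝ) ^ (k + 1)) ^ n)) ^ (1 / 2 : ℝ) := by
          gcongr
          · exact h2 t
          · exact hy.volume_le t _ (by positivity)
      _ = ENNReal.ofReal (((2 : ℝ) ^ k) ^ ((n : ℝ) / 2 - 1)) * ((M * 2 ^ n) ^ (1 / 2 : ℝ) *
            eLpNorm (weighted y (dyadicPiece y k f) t) 2 volume) := by
          have hρ : (0 : ℝ) < 2 ^ k := by positivity
          have e1 : M * ENNReal.ofReal (((2 : ℝ) ^ (k + 1)) ^ n) =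
              M * 2 ^ n * ENNReal.ofReal (((2 : ℝ) ^ k) ^ n) := by
            rw [zpow_add₀ two_ne_zero, zpow_one, mul_pow, mul_comm (_ ^ n), ENNReal.ofReal_mul
              (by positivity), ENNReal.ofReal_pow zero_le_two, ENNReal.ofReal_ofNat, mul_assoc]
          have e2 : ((2 : ℝ) ^ k) ^ ((n : ℝ) / 2 - 1) =
              ((2 : ℝ) ^ k)⁻¹ * (((2 : ℝ) ^ k) ^ n) ^ (1 / 2 : ℝ) := by
            rw [← Real.rpow_natCast, ← Real.rpow_mul hρ.le, ← Real.rpow_neg_one, ← Real.rpow_add hρ]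
            ring_nf
          rw [e1, e2, ENNReal.ofReal_mul (by positivity), ENNReal.mul_rpow_of_nonneg _ _
            (show (0 : ℝ) ≤ 1 / 2 by norm_num), ENNReal.ofReal_rpow_of_nonneg (by positivity)
            (by norm_num)]
          ring
      _ ≤ _ := by
          gcongr
          exact le_add_self

theorem sum_lintegral_sq (hy : IsWeight y M) (hf : IsWeighted y K f) :
    ∑ k ∈ Finset.Ico (-(K : ℤ)) K,
      ∫⁻ t, (pieceConst n M * eLpNorm (weighted y (dyadicPiece y k f) t) 2 volume) ^ 2 =
      pieceConst n M ^ 2 * ∫⁻ t, eLpNorm (weighted y f t) 2 volume ^ 2 := by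
  have hm : ∀ k, Measurable (Function.uncurry (weighted y (dyadicPiece y k f))) := fun k =>
    measurable_weighted hy.measurable (measurable_dyadicPiece hy.measurable hf.measurable k)
  simp only [mul_pow]
  rw [← lintegral_finsetSum]
  swap
  · exact fun k _ => ((measurable_eLpNorm_two (hm k)).pow_const 2).const_mul _
  rw [← lintegral_const_mul _ ((measurable_eLpNorm_two
    (measurable_weighted hy.measurable hf.measurable)).pow_const 2)]
  refine lintegral_congr fun t => ?_
  simp only [eLpNorm_two_sq]
  rw [← Finset.mul_sum, ← lintegral_finsetSum]
  · simp only [hf.sum_enorm_weighted_sq]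
  · exact fun k _ => (measurable_slice (hm k) t).enorm.pow_const 2

theorem enorm_integral_dyadicPiece_le (hn : 3 ≤ n) (hy : IsWeight y M) (hf : IsWeighted y K f)
    (j k : ℤ) :
    ‖∫ ξ, superpose (dyadicPiece y j f) ξ * conj (superpose (dyadicPiece y k f) ξ)‖ₑ ≤
      dyadicDecay (j - k) * (
      (∫⁻ t, (pieceConst n M * eLpNorm (weighted y (dyadicPiece y j f) t) 2 volume) ^ 2) ^ (1 / 2 : ℝ) *
      (∫⁻ t, (pieceConst n M * eLpNorm (weighted y (dyadicPiece y k f) t) 2 volume) ^ 2) ^ (1 / 2 : ℝ)) := by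
  have hj := hf.isSliceAtom_dyadicPiece hy j
  have hk := hf.isSliceAtom_dyadicPiece hy k
  have hdec : ∀ m : ℕ, ((2 : ℝ) ^ (-(m : ℤ))) ^ (1 / 4 : ℝ) = (2 ^ (-(1 / 4 : ℝ))) ^ m := fun m => by
    rw [← Real.rpow_intCast, ← Real.rpow_natCast, ← Real.rpow_mul zero_le_two,
      ← Real.rpow_mul zero_le_two]
    push_cast
    ring_nf
  rcases le_total j k with hjk | hjk
  · refine (hj.enorm_integral_superpose_mul_conj_le hn hk).trans_eq ?_
    rw [dyadicDecay, ← hdec, Int.natCast_natAbs, abs_of_nonpos (by linarith), neg_neg,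
      zpow_sub₀ two_ne_zero]
  · have hc : ∫ ξ, superpose (dyadicPiece y j f) ξ * conj (superpose (dyadicPiece y k f) ξ) =
        conj (∫ ξ, superpose (dyadicPiece y k f) ξ * conj (superpose (dyadicPiece y j f) ξ)) := by
      rw [← integral_conj]
      simp only [map_mul, RCLike.conj_conj, mul_comm]
    rw [hc, RCLike.enorm_conj]
    refine (hk.enorm_integral_superpose_mul_conj_le hn hj).trans_eq ?_
    rw [dyadicDecay, ← hdec, Int.natCast_natAbs, abs_of_nonneg (by linarith), neg_sub,
      zpow_sub₀ two_ne_zero, mul_comm (_ ^ (1 / 2 : ℝ))]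

/-- Weighted `L²` functions have a superposition in `L²`, with a bound which does not depend on
the truncation parameter `K`. -/
theorem eLpNorm_superpose_sq_le (hn : 3 ≤ n) (hy : IsWeight y M) (hf : IsWeighted y K f) :
    eLpNorm (superpose f) 2 volume ^ 2 ≤ 2 * (∑' m, dyadicDecay m) * pieceConst n M ^ 2 *
      ∫⁻ t, eLpNorm (weighted y f t) 2 volume ^ 2 := by
  set s := Finset.Ico (-(K : ℤ)) K
  have hsrc := fun k => hf.isSource_dyadicPiece hy k
  have hmem : ∀ {g : ℝ → Rn n → ℂ}, IsSource g → MemLp (superpose g) 2 := fun hg =>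
    ⟨(IsSource.measurable_superpose hg.measurable).aestronglyMeasurable,
      hg.eLpNorm_superpose_ne_top.lt_top⟩
  have hsum : ∀ ξ, superpose f ξ = ∑ k ∈ s, superpose (dyadicPiece y k f) ξ := fun ξ => by
    rw [← superpose_finset_sum s fun k _ => hsrc k]
    simp only [s, hf.sum_dyadicPiece]
  have hint : ∀ j k, Integrable fun ξ =>
      superpose (dyadicPiece y j f) ξ * conj (superpose (dyadicPiece y k f) ξ) := fun j k =>
    (hmem (hsrc j)).integrable_mul (hmem (hsrc k)).star
  rw [← enorm_integral_mul_conj_self (hmem (hf.isSource hy))]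
  simp only [hsum, map_sum, Finset.sum_mul_sum]
  rw [integral_finsetSum _ fun j _ => integrable_finsetSum _ fun k _ => hint j k]
  simp only [fun j => integral_finsetSum s fun k _ => hint j k]
  calc _ ≤ ∑ j ∈ s, ∑ k ∈ s,
        ‖∫ ξ, superpose (dyadicPiece y j f) ξ * conj (superpose (dyadicPiece y k f) ξ)‖ₑ :=
        (enorm_sum_le _ _).trans (Finset.sum_le_sum fun j _ => enorm_sum_le _ _)
    _ ≤ _ := Finset.sum_le_sum fun j _ => Finset.sum_le_sum fun k _ =>
        hf.enorm_integral_dyadicPiece_le hn hy j k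
    _ ≤ _ := sum_sum_mul_le s dyadicDecay (fun m => by simp [dyadicDecay]) _
    _ = _ := by
        simp only [ENNReal.rpow_half_sq]
        rw [hf.sum_lintegral_sq hy, mul_assoc, mul_assoc, mul_assoc]

end IsWeighted

end Weight

section Kato

variable {n : ℕ} {f : ℝ → Rn n → ℂ}

theorem tendsto_fourier_of_norm_le {u : ℕ → Rn n → ℂ} {v : Rn n → ℂ} (hv : Integrable v)
    (hu : ∀ K, Measurable (u K)) (hle : ∀ K x, ‖u K x‖ ≤ ‖v x‖)
    (hlim : ∀ᵐ x, Tendsto (fun K => u K x) atTop (𝓝 (v x))) (ξ : Rn n) :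
    Tendsto (fun K => 𝓕 (u K) ξ) atTop (𝓝 (𝓕 v ξ)) := by
  simp only [Real.fourier_eq]
  refine tendsto_integral_of_dominated_convergence (fun x => ‖v x‖) (fun K => ?_) hv.norm
    (fun K => Eventually.of_forall fun x => ?_) ?_
  · have := hu K
    simp only [Circle.smul_def, Real.fourierChar_apply, smul_eq_mul]
    exact Measurable.aestronglyMeasurable (by fun_prop)
  · rw [Circle.norm_smul]
    exact hle K x
  · filter_upwards [hlim] with x hx
    exact hx.const_smul _

theorem IsSource.tendsto_superpose {u : ℕ → ℝ → Rn n → ℂ} (hf : IsSource f)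
    (hu : ∀ K, Measurable (Function.uncurry (u K))) (hle : ∀ K t x, ‖u K t x‖ ≤ ‖f t x‖)
    (hlim : ∀ t, ∀ᵐ x, Tendsto (fun K => u K t x) atTop (𝓝 (f t x))) (ξ : Rn n) :
    Tendsto (fun K => superpose (u K) ξ) atTop (𝓝 (superpose f ξ)) := by
  refine tendsto_integral_of_dominated_convergence (fun s => (eLpNorm (f s) 1 volume).toReal)
    (fun K => ((hf.mono (hu K) (hle K)).integrable_evolved ξ).aestronglyMeasurable)
    (integrable_toReal_of_lintegral_ne_top (measurable_eLpNorm_one hf.measurable).aemeasurable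
      hf.lintegral_one_ne_top)
    (fun K => Eventually.of_forall fun s => ?_) (Eventually.of_forall fun s => ?_)
  · rw [← toReal_enorm]
    refine ENNReal.toReal_mono (hf.one_ne_top s) ?_
    exact (IsSource.enorm_evolved_le (u K) s ξ).trans (eLpNorm_mono (hle K s))
  · exact (tendsto_fourier_of_norm_le (hf.integrable s) (fun K => measurable_slice (hu K) s)
      (fun K => hle K s) (hlim s) ξ).const_mul _

theorem isWeight_norm (n : ℕ) :
    IsWeight (fun (_ : ℝ) (x : Rn n) => ‖x‖) (volume (Metric.ball (0 : Rn n) 1)) where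
  measurable := measurable_snd.norm
  ne_top := measure_ball_lt_top.ne
  volume_le t r hr := by
    calc volume {x : Rn n | 0 < ‖x‖ ∧ ‖x‖ < r} ≤ volume (Metric.ball (0 : Rn n) r) :=
          measure_mono fun x hx => by simpa using hx.2
      _ = _ := by
        rw [Measure.addHaar_ball_of_pos _ _ hr, finrank_euclideanSpace_fin, mul_comm]

/-- The restriction of `f` to the points where the weight `y` is between `2 ^ (-K)` and `2 ^ K`. -/
noncomputable def restrictWeight (y : ℝ → Rn n → ℝ) (K : ℕ) (f : ℝ → Rn n → ℂ) (t : ℝ) (x : Rn n) :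
    ℂ :=
  (Set.Ico ((2 : ℝ) ^ (-(K : ℤ))) (2 ^ (K : ℤ))).indicator (fun _ => f t x) (y t x)

theorem measurable_restrictWeight {y : ℝ → Rn n → ℝ} (hy : Measurable (Function.uncurry y))
    (hf : Measurable (Function.uncurry f)) (K : ℕ) :
    Measurable (Function.uncurry (restrictWeight y K f)) :=
  Measurable.indicator (s := Function.uncurry y ⁻¹' Set.Ico _ _) hf (hy measurableSet_Ico)

theorem norm_restrictWeight_le (y : ℝ → Rn n → ℝ) (K : ℕ) (f : ℝ → Rn n → ℂ) (t : ℝ) (x : Rn n) :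
    ‖restrictWeight y K f t x‖ ≤ ‖f t x‖ :=
  norm_indicator_le_norm_self (fun _ => f t x) _

theorem mem_Ico_of_restrictWeight_ne_zero {y : ℝ → Rn n → ℝ} {K : ℕ} {t : ℝ} {x : Rn n}
    (h : restrictWeight y K f t x ≠ 0) : y t x ∈ Set.Ico ((2 : ℝ) ^ (-(K : ℤ))) (2 ^ (K : ℤ)) :=
  Set.mem_of_indicator_ne_zero h

theorem eventually_restrictWeight_eq {y : ℝ → Rn n → ℝ} {t : ℝ} {x : Rn n} (h : 0 < y t x) :
    ∀ᶠ K in atTop, restrictWeight y K f t x = f t x := by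
  have h1 : Tendsto (fun K : ℕ => (2 : ℝ) ^ (-(K : ℤ))) atTop (𝓝 0) := by
    have := tendsto_pow_atTop_nhds_zero_of_lt_one (r := (2 : ℝ)⁻¹) (by norm_num) (by norm_num)
    simpa [zpow_neg] using this
  have h2 : Tendsto (fun K : ℕ => (2 : ℝ) ^ (K : ℤ)) atTop atTop := by
    simpa using tendsto_pow_atTop_atTop_of_one_lt (r := (2 : ℝ)) (by norm_num)
  filter_upwards [h1.eventually_le_const h, h2.eventually_gt_atTop (y t x)] with K h3 h4
  exact Set.indicator_of_mem (s := Set.Ico _ _) ⟨h3, h4⟩ _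

/-- The constant in the weighted estimate for `superpose`. -/
noncomputable def superposeConst (n : ℕ) (M : ℝ≥0∞) : ℝ≥0∞ :=
  2 * (∑' m, dyadicDecay m) * pieceConst n M ^ 2

theorem superposeConst_ne_top (n : ℕ) {M : ℝ≥0∞} (hM : M ≠ ⊤) : superposeConst n M ≠ ⊤ :=
  ENNReal.mul_ne_top (ENNReal.mul_ne_top (by norm_num) tsum_dyadicDecay_ne_top)
    (ENNReal.pow_ne_top (pieceConst_ne_top n hM))

theorem isWeighted_restrictWeight {y : ℝ → Rn n → ℝ} (hf : IsSource f)
    (hy : Measurable (Function.uncurry y)) (K : ℕ) :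
    IsWeighted y K (restrictWeight y K f) := by
  have hle : ∀ t x, ‖weighted y (restrictWeight y K f) t x‖ ≤ ‖((2 : ℂ) ^ K • f t) x‖ := by
    intro t x
    rw [weighted, norm_mul, Pi.smul_apply, norm_smul, mul_comm]
    by_cases h : restrictWeight y K f t x = 0
    · simp only [h, norm_zero, mul_zero]
      positivity
    · have h1 := mem_Ico_of_restrictWeight_ne_zero h
      gcongr
      · rw [Complex.norm_real, Real.norm_of_nonneg (le_trans (by positivity) h1.1)]
        simpa using h1.2.le
      · exact norm_restrictWeight_le _ _ _ _ _
  have hle2 : ∀ t, eLpNorm (weighted y (restrictWeight y K f) t) 2 volume ≤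
      ‖(2 : ℂ) ^ K‖ₑ * eLpNorm (f t) 2 volume := fun t =>
    (eLpNorm_mono (hle t)).trans_eq (eLpNorm_const_smul _ _ _ _)
  refine ⟨measurable_restrictWeight hy hf.measurable K,
    fun t x h => mem_Ico_of_restrictWeight_ne_zero h,
    fun t => ne_top_of_le_ne_top (ENNReal.mul_ne_top enorm_ne_top (hf.two_ne_top t)) (hle2 t),
    ne_top_of_le_ne_top (ENNReal.mul_ne_top enorm_ne_top hf.lintegral_two_ne_top)
      ((lintegral_mono hle2).trans_eq
        (lintegral_const_mul _ (measurable_eLpNorm_two hf.measurable)))⟩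

theorem IsSource.eLpNorm_superpose_sq_le_of_norm_mul_le (hn : 3 ≤ n) (hf : IsSource f)
    {g : ℝ → Rn n → ℂ} (hfg : ∀ t x, ‖f t x‖ * ‖x‖ ≤ ‖g t x‖) :
    eLpNorm (superpose f) 2 volume ^ 2 ≤
      superposeConst n (volume (Metric.ball (0 : Rn n) 1)) *
        ∫⁻ t, eLpNorm (g t) 2 volume ^ 2 := by
  have : Nonempty (Fin n) := ⟨⟨0, by omega⟩⟩
  set y : ℝ → Rn n → ℝ := fun _ x => ‖x‖ with hyd
  have hy : IsWeight y (volume (Metric.ball (0 : Rn n) 1)) := isWeight_norm n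
  have hm := measurable_restrictWeight hy.measurable hf.measurable
  rw [eLpNorm_two_sq]
  refine lintegral_le_of_tendsto (u := fun K ξ => ‖superpose (restrictWeight y K f) ξ‖ₑ ^ 2)
    (fun K => ((IsSource.measurable_superpose (hm K)).enorm.pow_const 2).aemeasurable)
    (Eventually.of_forall fun ξ => ?_) fun K => ?_
  · refine ENNReal.Tendsto.pow (Tendsto.enorm ?_)
    refine hf.tendsto_superpose hm (fun K => norm_restrictWeight_le y K f) (fun t => ?_) ξ
    filter_upwards [Measure.ae_ne volume (0 : Rn n)] with x hx
    exact tendsto_const_nhds.congr' ((eventually_restrictWeight_eq (norm_pos_iff.2 hx)).mono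
      fun K h => h.symm)
  · rw [← eLpNorm_two_sq]
    refine ((isWeighted_restrictWeight hf hy.measurable K).eLpNorm_superpose_sq_le hn hy).trans ?_
    rw [superposeConst]
    gcongr with t
    refine eLpNorm_mono fun x => le_trans ?_ (hfg t x)
    rw [weighted, norm_mul, hyd, Complex.norm_real, norm_norm]
    gcongr
    exact norm_restrictWeight_le _ _ _ _ _

/-- A Schwartz function of space-time is dominated by a product of integrable functions of time and
space. -/
theorem SchwartzMap.exists_norm_le_mul (g : 𝓢(ℝ × Rn n, ℂ)) :
    ∃ C : ℝ, ∀ s x, ‖g (s, x)‖ ≤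
      C * (1 + ‖s‖) ^ (-(2 : ℝ)) * (1 + ‖x‖) ^ (-((n : ℝ) + 1)) := by
  obtain ⟨C, hC⟩ : ∃ C : ℝ, ∀ z, (1 + ‖z‖) ^ (2 + (n + 1)) * ‖g z‖ ≤ C :=
    ⟨_, fun z => by
      simpa using SchwartzMap.one_add_le_sup_seminorm_apply (𝕜 := ℝ) (m := (2 + (n + 1), 0))
        le_rfl le_rfl g z⟩
  refine ⟨C, fun s x => ?_⟩
  have h2 : (1 + ‖s‖) ^ (-(2 : ℝ)) = ((1 + ‖s‖) ^ 2)⁻¹ := by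
    rw [Real.rpow_neg (by positivity)]
    norm_cast
  have h3 : (1 + ‖x‖) ^ (-((n : ℝ) + 1)) = ((1 + ‖x‖) ^ (n + 1))⁻¹ := by
    rw [Real.rpow_neg (by positivity)]
    norm_cast
  rw [h2, h3, mul_assoc, ← mul_inv, ← div_eq_mul_inv, le_div_iff₀ (by positivity), mul_comm]
  refine le_trans ?_ (hC (s, x))
  rw [pow_add (1 + ‖(s, x)‖) 2]
  gcongr
  · exact norm_fst_le (s, x)
  · exact norm_snd_le (s, x)

theorem isSource_mul_schwartz {w : Rn n → ℂ} (hw : Measurable w) (hw1 : ∀ x, ‖w x‖ ≤ 1)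
    (g : 𝓢(ℝ × Rn n, ℂ)) : IsSource fun t x => w x * g (t, x) := by
  obtain ⟨C, hC⟩ := g.exists_norm_le_mul
  set a : ℝ → ℝ := fun s => C * (1 + ‖s‖) ^ (-(2 : ℝ)) with ha
  set b : Rn n → ℝ := fun x => (1 + ‖x‖) ^ (-((n : ℝ) + 1)) with hb
  have ha1 : Integrable a := (integrable_one_add_norm (by simp)).const_mul C
  have hb1 : Integrable b := integrable_one_add_norm (by simp)
  have hb0 : ∀ x, ‖b x‖ ≤ 1 := fun x => by
    rw [hb, Real.norm_of_nonneg (by positivity)]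
    exact Real.rpow_le_one_of_one_le_of_nonpos (by simp) (by linarith [n.cast_nonneg (α := ℝ)])
  have hb2 : ∀ p, p = 1 ∨ p = 2 → eLpNorm b p volume ≠ ⊤ := by
    rintro p (rfl | rfl)
    · exact (memLp_one_iff_integrable.2 hb1).eLpNorm_ne_top
    · refine ((memLp_two_iff_integrable_sq hb1.1).2 (hb1.mono (hb1.1.pow 2)
        (Eventually.of_forall fun x => ?_))).eLpNorm_ne_top
      rw [norm_pow, sq]
      exact mul_le_of_le_one_left (norm_nonneg _) (hb0 x)
  have hle : ∀ p t, eLpNorm (fun x => w x * g (t, x)) p volume ≤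
      ‖a t‖ₑ * eLpNorm b p volume := fun p t => by
    rw [← eLpNorm_const_smul]
    refine eLpNorm_mono fun x => ?_
    rw [norm_mul, Pi.smul_apply, smul_eq_mul]
    exact (mul_le_of_le_one_left (norm_nonneg _) (hw1 x)).trans
      ((hC t x).trans (Real.le_norm_self _))
  have hfin : ∀ p, p = 1 ∨ p = 2 → ∫⁻ t, eLpNorm (fun x => w x * g (t, x)) p volume ≠ ⊤ := by
    intro p hp
    refine ne_top_of_le_ne_top ?_ (lintegral_mono (hle p))
    rw [lintegral_mul_const' _ _ (hb2 p hp)]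
    exact ENNReal.mul_ne_top ha1.2.ne (hb2 p hp)
  refine ⟨?_, fun t => ?_, fun t => ?_, hfin 1 (.inl rfl), hfin 2 (.inr rfl)⟩
  · exact (hw.comp measurable_snd).mul g.continuous.measurable
  · exact ne_top_of_le_ne_top (ENNReal.mul_ne_top enorm_ne_top (hb2 1 (.inl rfl))) (hle 1 t)
  · exact ne_top_of_le_ne_top (ENNReal.mul_ne_top enorm_ne_top (hb2 2 (.inr rfl))) (hle 2 t)

/-- Kato smoothing: the square root of the constant is the norm of the operator `g ↦ superpose (w g)`
on `L²`. -/
theorem eLpNorm_superpose_mul_schwartz_sq_le (hn : 3 ≤ n) {w : Rn n → ℂ} (hw : Measurable w)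
    (hw1 : ∀ x, ‖w x‖ ≤ (1 + ‖x‖ ^ 2) ^ (-(1 : ℝ) / 2)) (g : 𝓢(ℝ × Rn n, ℂ)) :
    eLpNorm (superpose fun t x => w x * g (t, x)) 2 volume ^ 2 ≤
      superposeConst n (volume (Metric.ball (0 : Rn n) 1)) * eLpNorm (⇑g) 2 volume ^ 2 := by
  have h1 : ∀ x, ‖w x‖ ≤ 1 := fun x => (hw1 x).trans
    (Real.rpow_le_one_of_one_le_of_nonpos (by nlinarith [norm_nonneg x]) (by norm_num))
  have h2 : ∀ x, ‖w x‖ * ‖x‖ ≤ 1 := fun x => by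
    have h3 : ‖x‖ ≤ (1 + ‖x‖ ^ 2) ^ ((1 : ℝ) / 2) := by
      rw [← Real.sqrt_eq_rpow]
      exact Real.le_sqrt_of_sq_le (by linarith)
    calc ‖w x‖ * ‖x‖ ≤ (1 + ‖x‖ ^ 2) ^ (-(1 : ℝ) / 2) * (1 + ‖x‖ ^ 2) ^ ((1 : ℝ) / 2) := by
          gcongr
          exact hw1 x
      _ = 1 := by
        rw [← Real.rpow_add (by positivity)]
        norm_num
  refine ((isSource_mul_schwartz hw h1 g).eLpNorm_superpose_sq_le_of_norm_mul_le hn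
    (g := fun t x => g (t, x)) fun t x => ?_).trans_eq ?_
  · rw [norm_mul, mul_right_comm]
    exact mul_le_of_le_one_left (norm_nonneg _) (h2 x)
  · simp only [eLpNorm_two_sq]
    rw [Measure.volume_eq_prod, lintegral_prod _ (by
      exact (g.continuous.measurable.enorm.pow_const 2).aemeasurable)]

end Kato

section Duality

variable {n : ℕ} {f G : ℝ → Rn n → ℂ} {y : ℝ → Rn n → ℝ} {M : ℝ≥0∞}

theorem integral_ofReal_norm_sq {u : Rn n → ℂ} (hu : Measurable u) :
    ∫ x, ((‖u x‖ ^ 2 : ℝ) : ℂ) = (((eLpNorm u 2 volume ^ 2).toReal : ℝ) : ℂ) := by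
  rw [integral_complex_ofReal, integral_eq_lintegral_of_nonneg_ae
    (Eventually.of_forall fun x => sq_nonneg _) (hu.norm.pow_const 2).aestronglyMeasurable,
    eLpNorm_two_sq]
  simp [ENNReal.ofReal_pow]

theorem enorm_integral_integral_norm_sq {W : ℝ → Rn n → ℂ} (hW : Measurable (Function.uncurry W))
    (hfin : ∀ t, eLpNorm (W t) 2 volume ≠ ⊤) (hfin2 : ∫⁻ t, eLpNorm (W t) 2 volume ^ 2 ≠ ⊤) :
    ‖∫ t, ∫ x, ((‖W t x‖ ^ 2 : ℝ) : ℂ)‖ₑ = ∫⁻ t, eLpNorm (W t) 2 volume ^ 2 := by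
  simp only [fun t => integral_ofReal_norm_sq (measurable_slice hW t)]
  rw [integral_complex_ofReal, integral_toReal
    ((measurable_eLpNorm_two hW).pow_const 2).aemeasurable
    (Eventually.of_forall fun t => (ENNReal.pow_ne_top (hfin t)).lt_top), ← ofReal_norm,
    Complex.norm_real, Real.norm_of_nonneg ENNReal.toReal_nonneg, ENNReal.ofReal_toReal hfin2]

theorem weighted_restrictWeight (y : ℝ → Rn n → ℝ) (K : ℕ) (G : ℝ → Rn n → ℂ) :
    weighted y (restrictWeight y K G) = restrictWeight y K (weighted y G) := by
  ext t x
  simp only [weighted, restrictWeight, Set.indicator]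
  split_ifs <;> simp

theorem lintegral_eLpNorm_two_sq {u : ℝ → Rn n → ℂ} (hu : Measurable (Function.uncurry u)) :
    ∫⁻ t, eLpNorm (u t) 2 volume ^ 2 =
      ∫⁻ z, ‖Function.uncurry u z‖ₑ ^ 2 ∂(volume : Measure ℝ).prod (volume : Measure (Rn n)) := by
  simp only [eLpNorm_two_sq]
  exact (lintegral_prod _ (hu.enorm.pow_const 2).aemeasurable).symm

theorem IsSource.lintegral_weighted_sq_le (hn : 3 ≤ n) (hf : IsSource f) (hy : IsWeight y M)
    (hG : Measurable (Function.uncurry G))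
    (hpair : ∀ t x, duhamel f t x * conj (G t x) = ((‖weighted y G t x‖ ^ 2 : ℝ) : ℂ))
    (hpos : ∀ t x, G t x ≠ 0 → 0 < y t x)
    (hfin : ∀ t, eLpNorm (weighted y G t) 2 volume ≠ ⊤)
    (hfin1 : ∫⁻ t, eLpNorm (weighted y G t) 2 volume ≠ ⊤)
    (hfin2 : ∫⁻ t, eLpNorm (weighted y G t) 2 volume ^ 2 ≠ ⊤) :
    ∫⁻ t, eLpNorm (weighted y G t) 2 volume ^ 2 ≤
      superposeConst n M * eLpNorm (superpose f) 2 volume ^ 2 := by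
  set Q := ∫⁻ t, eLpNorm (weighted y G t) 2 volume ^ 2 with hQ
  set A := eLpNorm (superpose f) 2 volume with hA
  have hGm := measurable_restrictWeight hy.measurable hG
  have hle : ∀ K t, eLpNorm (weighted y (restrictWeight y K G) t) 2 volume ≤
      eLpNorm (weighted y G t) 2 volume := fun K t => by
    rw [weighted_restrictWeight]
    exact eLpNorm_mono (norm_restrictWeight_le _ _ _ _)
  have hW : ∀ K, IsWeighted y K (restrictWeight y K G) := fun K =>
    ⟨hGm K, fun t x h => mem_Ico_of_restrictWeight_ne_zero h,
      fun t => ne_top_of_le_ne_top (hfin t) (hle K t),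
      ne_top_of_le_ne_top hfin1 (lintegral_mono (hle K))⟩
  have hle2 : ∀ K, ∫⁻ t, eLpNorm (weighted y (restrictWeight y K G) t) 2 volume ^ 2 ≤ Q :=
    fun K => lintegral_mono fun t => by gcongr; exact hle K t
  have hK : ∀ K, ∫⁻ t, eLpNorm (weighted y (restrictWeight y K G) t) 2 volume ^ 2 ≤
      (superposeConst n M * A ^ 2 * Q) ^ (1 / 2 : ℝ) := fun K => by
    have h1 : ∀ t x, duhamel f t x * conj (restrictWeight y K G t x) =
        ((‖weighted y (restrictWeight y K G) t x‖ ^ 2 : ℝ) : ℂ) := fun t x => by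
      rw [weighted_restrictWeight]
      simp only [restrictWeight, Set.indicator]
      split_ifs
      · exact hpair t x
      · simp
    rw [← enorm_integral_integral_norm_sq (measurable_weighted hy.measurable (hGm K))
      (fun t => (hW K).ne_top t) (ne_top_of_le_ne_top hfin2 (hle2 K))]
    simp only [← h1]
    refine (hf.enorm_integral_integral_duhamel_mul_conj_le ((hW K).isSource hy)).trans ?_
    rw [← ENNReal.pow_le_pow_left_iff two_ne_zero, ENNReal.rpow_half_sq, mul_pow,
      mul_right_comm, mul_comm (A ^ 2)]
    gcongr
    exact ((hW K).eLpNorm_superpose_sq_le hn hy).trans (by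
      rw [superposeConst]
      gcongr
      exact hle2 K)
  have hlim : Q ≤ (superposeConst n M * A ^ 2 * Q) ^ (1 / 2 : ℝ) := by
    generalize (superposeConst n M * A ^ 2 * Q) ^ (1 / 2 : ℝ) = D at hK ⊢
    rw [hQ, lintegral_eLpNorm_two_sq (measurable_weighted hy.measurable hG)]
    refine lintegral_le_of_tendsto
      (u := fun K z => ‖Function.uncurry (weighted y (restrictWeight y K G)) z‖ₑ ^ 2)
      (fun K => ((measurable_weighted hy.measurable (hGm K)).enorm.pow_const 2).aemeasurable)
      (Eventually.of_forall fun z => ?_) fun K => ?_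
    · refine ENNReal.Tendsto.pow (Tendsto.enorm (tendsto_const_nhds.congr' ?_))
      rcases eq_or_ne (G z.1 z.2) 0 with h | h
      · exact Eventually.of_forall fun K => by simp [Function.uncurry, weighted, restrictWeight, h]
      · filter_upwards [eventually_restrictWeight_eq (f := G) (hpos _ _ h)] with K h2
        rw [Function.uncurry, Function.uncurry, weighted, weighted, h2]
    · rw [← lintegral_eLpNorm_two_sq (measurable_weighted hy.measurable (hGm K))]
      exact hK K
  refine ENNReal.le_of_sq_le_mul hfin2 ?_
  calc Q ^ 2 ≤ ((superposeConst n M * A ^ 2 * Q) ^ (1 / 2 : ℝ)) ^ 2 := by gcongr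
    _ = _ := ENNReal.rpow_half_sq _

end Duality

section Endpoint

variable {n : ℕ} {f H : ℝ → Rn n → ℂ} {q : ℝ≥0∞} {α : ℝ}

theorem measurable_eLpNorm_slice {f : ℝ → Rn n → ℂ} (hf : Measurable (Function.uncurry f))
    (hq0 : q ≠ 0) (hq : q ≠ ⊤) : Measurable fun t => eLpNorm (f t) q volume := by
  simp only [eLpNorm_eq_lintegral_rpow_enorm_toReal hq0 hq]
  exact (Measurable.lintegral_prod_right (hf.enorm.pow_const _)).pow_const _

theorem eLpNorm_rpow_toReal (hq0 : q ≠ 0) (hq : q ≠ ⊤) (u : Rn n → ℂ) :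
    eLpNorm u q volume ^ q.toReal = ∫⁻ x, ‖u x‖ₑ ^ q.toReal := by
  rw [eLpNorm_eq_lintegral_rpow_enorm_toReal hq0 hq, ← ENNReal.rpow_mul,
    one_div_mul_cancel (ENNReal.toReal_pos hq0 hq).ne', ENNReal.rpow_one]

/-- The modulus of the time slice `H t`, normalised in `L^q`. -/
noncomputable def profile (q : ℝ≥0∞) (H : ℝ → Rn n → ℂ) (t : ℝ) (x : Rn n) : ℝ :=
  ‖H t x‖ / (eLpNorm (H t) q volume).toReal

theorem profile_nonneg (q : ℝ≥0∞) (H : ℝ → Rn n → ℂ) (t : ℝ) (x : Rn n) : 0 ≤ profile q H t x :=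
  div_nonneg (norm_nonneg _) ENNReal.toReal_nonneg

theorem measurable_profile (hH : Measurable (Function.uncurry H)) (hq0 : q ≠ 0) (hq : q ≠ ⊤) :
    Measurable (Function.uncurry (profile q H)) :=
  hH.norm.div ((measurable_eLpNorm_slice hH hq0 hq).ennreal_toReal.comp measurable_fst)

theorem lintegral_profile (hq0 : q ≠ 0) (hq : q ≠ ⊤) {t : ℝ} (hH : eLpNorm (H t) q volume ≠ ⊤)
    (h0 : eLpNorm (H t) q volume ≠ 0) :
    ∫⁻ x, ENNReal.ofReal (profile q H t x ^ q.toReal) = 1 := by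
  have hr : 0 < q.toReal := ENNReal.toReal_pos hq0 hq
  have hb : 0 < (eLpNorm (H t) q volume).toReal := ENNReal.toReal_pos h0 hH
  have h1 : ∀ x, ENNReal.ofReal (profile q H t x ^ q.toReal) =
      ‖H t x‖ₑ ^ q.toReal * (eLpNorm (H t) q volume ^ q.toReal)⁻¹ := fun x => by
    rw [← ENNReal.ofReal_rpow_of_nonneg (profile_nonneg q H t x) hr.le, profile,
      ENNReal.ofReal_div_of_pos hb, ofReal_norm, ENNReal.ofReal_toReal hH,
      ENNReal.div_rpow_of_nonneg _ _ hr.le, div_eq_mul_inv]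
  simp only [h1]
  have h2 := (ENNReal.rpow_pos (p := q.toReal) (pos_iff_ne_zero.2 h0) hH).ne'
  rw [lintegral_mul_const' _ _ (ENNReal.inv_ne_top.2 h2), ← eLpNorm_rpow_toReal hq0 hq]
  exact ENNReal.mul_inv_cancel h2 (ENNReal.rpow_ne_top_of_nonneg hr.le hH)

theorem profile_eq_zero {t : ℝ} (h0 : eLpNorm (H t) q volume = 0) (x : Rn n) :
    profile q H t x = 0 := by
  simp [profile, h0]

theorem lintegral_profile_le (hq0 : q ≠ 0) (hq : q ≠ ⊤) {t : ℝ}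
    (hH : eLpNorm (H t) q volume ≠ ⊤) :
    ∫⁻ x, ENNReal.ofReal (profile q H t x ^ q.toReal) ≤ 1 := by
  rcases eq_or_ne (eLpNorm (H t) q volume) 0 with h0 | h0
  · simp [profile_eq_zero h0, Real.zero_rpow (ENNReal.toReal_pos hq0 hq).ne']
  · exact (lintegral_profile hq0 hq hH h0).le

theorem isWeight_profile (hq0 : q ≠ 0) (hq : q ≠ ⊤) (hα : 0 < α) (hαn : α * n = q.toReal)
    (hHm : Measurable (Function.uncurry H)) (hH : ∀ t, eLpNorm (H t) q volume ≠ ⊤) :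
    IsWeight (fun t x => profile q H t x ^ (-α)) 1 where
  measurable := (measurable_profile hHm hq0 hq).pow_const _
  ne_top := ENNReal.one_ne_top
  volume_le t r hr := by
    have hm : Measurable (profile q H t) :=
      (measurable_profile hHm hq0 hq).comp measurable_prodMk_left
    have hS : MeasurableSet {x | 0 < profile q H t x ^ (-α) ∧ profile q H t x ^ (-α) < r} :=
      (measurableSet_lt measurable_const (hm.pow_const _)).inter
        (measurableSet_lt (hm.pow_const _) measurable_const)
    rw [← lintegral_indicator_one hS, one_mul]
    calc ∫⁻ x, Set.indicator {x | 0 < profile q H t x ^ (-α) ∧ profile q H t x ^ (-α) < r} 1 x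
        ≤ ∫⁻ x, ENNReal.ofReal (r ^ n) * ENNReal.ofReal (profile q H t x ^ q.toReal) := by
          refine lintegral_mono (Set.indicator_le fun x hx => ?_)
          have hv : 0 < profile q H t x := by
            refine lt_of_le_of_ne (profile_nonneg q H t x) fun h => ?_
            have := hx.1
            rw [← h, Real.zero_rpow (by linarith)] at this
            exact this.false
          have h1 : 1 ≤ r * profile q H t x ^ α := by
            have h2 := hx.2
            rw [Real.rpow_neg hv.le, inv_lt_iff_one_lt_mul₀ (Real.rpow_pos_of_pos hv α)] at h2
            linarith
          rw [← ENNReal.ofReal_mul (by positivity), ← hαn, Real.rpow_mul_natCast hv.le, ← mul_pow]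
          exact ENNReal.one_le_ofReal.2 (one_le_pow₀ h1)
      _ = ENNReal.ofReal (r ^ n) * ∫⁻ x, ENNReal.ofReal (profile q H t x ^ q.toReal) :=
          lintegral_const_mul' _ _ ENNReal.ofReal_ne_top
      _ ≤ ENNReal.ofReal (r ^ n) :=
          mul_le_of_le_one_right' (lintegral_profile_le hq0 hq (hH t))

/-- The function which is dual to `H` in `L^q`, up to normalisation. -/
noncomputable def dualProfile (q : ℝ≥0∞) (α : ℝ) (H : ℝ → Rn n → ℂ) (t : ℝ) (x : Rn n) : ℂ :=
  ((profile q H t x ^ (2 * α) : ℝ) : ℂ) * H t x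

theorem norm_weighted_dualProfile_sq (hα : 0 < α) (t : ℝ) (x : Rn n) :
    ‖weighted (fun t x => profile q H t x ^ (-α)) (dualProfile q α H) t x‖ ^ 2 =
      profile q H t x ^ (2 * α) * ‖H t x‖ ^ 2 := by
  rw [weighted, dualProfile, norm_mul, norm_mul, Complex.norm_real, Complex.norm_real,
    Real.norm_of_nonneg (Real.rpow_nonneg (profile_nonneg q H t x) _),
    Real.norm_of_nonneg (Real.rpow_nonneg (profile_nonneg q H t x) _)]
  rcases (profile_nonneg q H t x).eq_or_lt with h | h
  · rw [← h, Real.zero_rpow (by positivity)]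
    simp
  · have h1 : profile q H t x ^ (2 * α) = (profile q H t x ^ α) ^ 2 := by
      rw [mul_comm, Real.rpow_mul h.le, Real.rpow_two]
    rw [h1, Real.rpow_neg h.le]
    have := (Real.rpow_pos_of_pos h α).ne'
    field_simp

theorem eLpNorm_weighted_dualProfile (hq0 : q ≠ 0) (hq : q ≠ ⊤) (hα : 0 < α)
    (hqα : q.toReal = 2 + 2 * α) {t : ℝ} (hH : eLpNorm (H t) q volume ≠ ⊤) :
    eLpNorm (weighted (fun t x => profile q H t x ^ (-α)) (dualProfile q α H) t) 2 volume =
      eLpNorm (H t) q volume := by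
  rw [eLpNorm_two_eq, ← ENNReal.sq_rpow_half (eLpNorm (H t) q volume)]
  congr 1
  have h1 : ∀ x, ‖weighted (fun t x => profile q H t x ^ (-α)) (dualProfile q α H) t x‖ₑ ^ 2 =
      ENNReal.ofReal (profile q H t x ^ (2 * α) * ‖H t x‖ ^ 2) := fun x => by
    rw [← norm_weighted_dualProfile_sq hα, ENNReal.ofReal_pow (norm_nonneg _), ofReal_norm]
  simp only [h1]
  rcases eq_or_ne (eLpNorm (H t) q volume) 0 with h0 | h0
  · simp [profile_eq_zero h0, Real.zero_rpow (mul_pos two_pos hα).ne', h0]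
  · have hb : 0 < (eLpNorm (H t) q volume).toReal := ENNReal.toReal_pos h0 hH
    have h2 : ∀ x, ENNReal.ofReal (profile q H t x ^ (2 * α) * ‖H t x‖ ^ 2) =
        eLpNorm (H t) q volume ^ 2 * ENNReal.ofReal (profile q H t x ^ q.toReal) := fun x => by
      have h3 : ‖H t x‖ = (eLpNorm (H t) q volume).toReal * profile q H t x :=
        (mul_div_cancel₀ _ hb.ne').symm
      rw [h3, mul_pow, hqα, mul_left_comm, ← Real.rpow_two (profile q H t x),
        ← Real.rpow_add_of_nonneg (profile_nonneg q H t x) (by positivity) (by norm_num),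
        add_comm (2 * α), ENNReal.ofReal_mul (by positivity), ENNReal.ofReal_pow hb.le,
        ENNReal.ofReal_toReal hH]
    simp only [h2]
    rw [lintegral_const_mul' _ _ (ENNReal.pow_ne_top hH), lintegral_profile hq0 hq hH h0, mul_one]

theorem duhamel_mul_conj_dualProfile (hα : 0 < α) (hHf : ∀ t x, H t x = 0 ∨ H t x = duhamel f t x)
    (t : ℝ) (x : Rn n) : duhamel f t x * conj (dualProfile q α H t x) =
      ((‖weighted (fun t x => profile q H t x ^ (-α)) (dualProfile q α H) t x‖ ^ 2 : ℝ) : ℂ) := by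
  rw [norm_weighted_dualProfile_sq hα, dualProfile, map_mul, Complex.conj_ofReal]
  rcases hHf t x with h | h
  · simp [h]
  · rw [← h, Complex.ofReal_mul, Complex.ofReal_pow, ← Complex.mul_conj']
    ring

theorem IsSource.lintegral_eLpNorm_sq_le (hn : 3 ≤ n) (hf : IsSource f) (hq0 : q ≠ 0) (hq : q ≠ ⊤)
    (hα : 0 < α) (hαn : α * n = q.toReal) (hqα : q.toReal = 2 + 2 * α)
    (hHm : Measurable (Function.uncurry H)) (hHf : ∀ t x, H t x = 0 ∨ H t x = duhamel f t x)
    (hH : ∀ t, eLpNorm (H t) q volume ≠ ⊤) (hH1 : ∫⁻ t, eLpNorm (H t) q volume ≠ ⊤)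
    (hH2 : ∫⁻ t, eLpNorm (H t) q volume ^ 2 ≠ ⊤) :
    ∫⁻ t, eLpNorm (H t) q volume ^ 2 ≤
      superposeConst n 1 * eLpNorm (superpose f) 2 volume ^ 2 := by
  have hy := isWeight_profile hq0 hq hα hαn hHm hH
  have hW := fun t => eLpNorm_weighted_dualProfile hq0 hq hα hqα (hH t)
  simp only [← hW] at hH hH1 hH2 ⊢
  refine hf.lintegral_weighted_sq_le hn hy ?_ (duhamel_mul_conj_dualProfile hα hHf) ?_ hH hH1 hH2
  · exact (Complex.measurable_ofReal.comp ((measurable_profile hHm hq0 hq).pow_const _)).mul hHm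
  · intro t x h
    refine Real.rpow_pos_of_pos (lt_of_le_of_ne (profile_nonneg q H t x) fun h0 => h ?_) _
    rw [dualProfile, ← h0, Real.zero_rpow (by positivity)]
    simp

end Endpoint

section Truncation

variable {n : ℕ} {f F : ℝ → Rn n → ℂ} {q : ℝ≥0∞} {α : ℝ}

/-- The truncation of `F t` for times of absolute value at most `N`. -/
noncomputable def timeTruncation (F : ℝ → Rn n → ℂ) (N : ℕ) (t : ℝ) (x : Rn n) : ℂ :=
  (Metric.closedBall (0 : ℝ) N).indicator (fun t => truncation (F t) N x) t

theorem measurable_timeTruncation (hF : Measurable (Function.uncurry F)) (N : ℕ) :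
    Measurable (Function.uncurry (timeTruncation F N)) := by
  have h : Measurable fun z : ℝ × Rn n => truncation (F z.1) N z.2 :=
    Measurable.indicator (s := {z : ℝ × Rn n | ‖z.2‖ ≤ N ∧ ‖F z.1 z.2‖ ≤ N}) hF
      ((measurableSet_le measurable_snd.norm measurable_const).inter
        (measurableSet_le hF.norm measurable_const))
  exact Measurable.indicator (s := Prod.fst ⁻¹' Metric.closedBall (0 : ℝ) N) h
    (measurable_fst measurableSet_closedBall)

theorem timeTruncation_eq (F : ℝ → Rn n → ℂ) (N : ℕ) (t : ℝ) (x : Rn n) :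
    timeTruncation F N t x = 0 ∨ timeTruncation F N t x = F t x := by
  simp only [timeTruncation, truncation, Set.indicator]
  split_ifs <;> simp

theorem tendsto_timeTruncation (F : ℝ → Rn n → ℂ) (t : ℝ) (x : Rn n) :
    Tendsto (fun N => timeTruncation F N t x) atTop (𝓝 (F t x)) := by
  refine (tendsto_truncation (F t) x).congr' ?_
  filter_upwards [eventually_ge_atTop ⌈‖t‖⌉₊] with N hN
  rw [timeTruncation, Set.indicator_of_mem (by simpa using hN)]

theorem eLpNorm_timeTruncation_le (F : ℝ → Rn n → ℂ) (N : ℕ) (t : ℝ) :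
    eLpNorm (timeTruncation F N t) q volume ≤ (Metric.closedBall (0 : ℝ) N).indicator
      (fun _ => (N : ℝ≥0∞) * volume (Metric.closedBall (0 : Rn n) N) ^ (1 / q.toReal)) t := by
  by_cases ht : t ∈ Metric.closedBall (0 : ℝ) N
  · rw [Set.indicator_of_mem ht]
    refine (eLpNorm_mono (g := (Metric.closedBall (0 : Rn n) N).indicator fun _ => (N : ℝ))
      fun x => ?_).trans ((eLpNorm_indicator_const_le _ _).trans_eq (by simp))
    rw [timeTruncation, Set.indicator_of_mem ht]
    by_cases hx : x ∈ Metric.closedBall (0 : Rn n) N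
    · rw [Set.indicator_of_mem hx, Real.norm_natCast]
      exact norm_truncation_le _ _ _
    · rw [truncation, Set.indicator_of_notMem fun h => hx (by simpa using h.1)]
      simp
  · have h : timeTruncation F N t = 0 := by
      ext x
      rw [timeTruncation, Set.indicator_of_notMem ht, Pi.zero_apply]
    simp [h]

theorem lintegral_eLpNorm_timeTruncation_rpow_ne_top (F : ℝ → Rn n → ℂ) (N : ℕ) {k : ℕ}
    (hk : k ≠ 0) : ∫⁻ t, eLpNorm (timeTruncation F N t) q volume ^ k ≠ ⊤ := by
  refine ne_top_of_le_ne_top ?_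
    (lintegral_mono fun t => pow_le_pow_left' (eLpNorm_timeTruncation_le F N t) k)
  have h : ∀ c : ℝ≥0∞, (fun t : ℝ => (Metric.closedBall (0 : ℝ) N).indicator (fun _ => c) t ^ k) =
      (Metric.closedBall (0 : ℝ) N).indicator fun _ => c ^ k := fun c => by
    ext t
    by_cases ht : t ∈ Metric.closedBall (0 : ℝ) N <;> simp [Set.indicator, ht, hk]
  rw [h, lintegral_indicator_const measurableSet_closedBall]
  refine ENNReal.mul_ne_top (ENNReal.pow_ne_top (ENNReal.mul_ne_top (by simp)
    (ENNReal.rpow_ne_top_of_nonneg (by positivity) measure_closedBall_lt_top.ne)))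
    measure_closedBall_lt_top.ne

theorem tendsto_eLpNorm_timeTruncation (hF : Measurable (Function.uncurry F)) (t : ℝ) :
    Tendsto (fun N => eLpNorm (timeTruncation F N t) q volume) atTop (𝓝 (eLpNorm (F t) q volume)) := by
  refine tendsto_of_le_liminf_of_limsup_le
    (Lp.eLpNorm_lim_le_liminf_eLpNorm
      (fun N => (measurable_slice (measurable_timeTruncation hF N) t).aestronglyMeasurable) _
      (Eventually.of_forall fun x => tendsto_timeTruncation F t x))
    (limsup_le_of_le (h := Eventually.of_forall fun N => eLpNorm_mono fun x => ?_))
  rcases timeTruncation_eq F N t x with h | h <;> simp [h]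

theorem IsSource.lintegral_eLpNorm_duhamel_sq_le (hn : 3 ≤ n) (hf : IsSource f) (hq0 : q ≠ 0)
    (hq : q ≠ ⊤) (hα : 0 < α) (hαn : α * n = q.toReal) (hqα : q.toReal = 2 + 2 * α) :
    ∫⁻ t, eLpNorm (duhamel f t) q volume ^ 2 ≤
      superposeConst n 1 * eLpNorm (superpose f) 2 volume ^ 2 := by
  have hF := measurable_duhamel hf.measurable
  have hm := fun N => measurable_timeTruncation hF N
  refine lintegral_le_of_tendsto
    (u := fun N t => eLpNorm (timeTruncation (duhamel f) N t) q volume ^ 2)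
    (fun N => ((measurable_eLpNorm_slice (hm N) hq0 hq).pow_const 2).aemeasurable)
    (Eventually.of_forall fun t => ENNReal.Tendsto.pow (tendsto_eLpNorm_timeTruncation hF t))
    fun N => ?_
  refine hf.lintegral_eLpNorm_sq_le hn hq0 hq hα hαn hqα (hm N) (timeTruncation_eq _ N)
    (fun t => ne_top_of_le_ne_top ?_ (eLpNorm_timeTruncation_le _ N t)) ?_
    (lintegral_eLpNorm_timeTruncation_rpow_ne_top _ N two_ne_zero)
  · refine ne_top_of_le_ne_top ?_ (Set.indicator_le_self _ _ t)
    exact ENNReal.mul_ne_top (by simp)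
      (ENNReal.rpow_ne_top_of_nonneg (by positivity) measure_closedBall_lt_top.ne)
  · simpa using lintegral_eLpNorm_timeTruncation_rpow_ne_top (duhamel f) N one_ne_zero (q := q)

end Truncation

section Interpolation

variable {n : ℕ} {p q : ℝ≥0∞}

theorem ne_top_of_admissible (hn : 3 ≤ n) (hp : 2 ≤ p)
    (hpq : 2 / p + (n : ℝ≥0∞) / q = (n : ℝ≥0∞) / 2) : q ≠ ⊤ := by
  rintro rfl
  have h1 : (2 : ℝ≥0∞) / p ≤ 1 := ENNReal.div_le_of_le_mul (by simpa using hp)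
  rw [ENNReal.div_top, add_zero] at hpq
  rw [hpq, ENNReal.div_le_iff_le_mul (by simp) (by simp), one_mul] at h1
  have : n ≤ 2 := by exact_mod_cast h1
  omega

theorem eq_two_of_admissible_top (hn : 3 ≤ n)
    (hpq : 2 / (⊤ : ℝ≥0∞) + (n : ℝ≥0∞) / q = (n : ℝ≥0∞) / 2) : q = 2 := by
  rw [ENNReal.div_top, zero_add, div_eq_mul_inv, div_eq_mul_inv] at hpq
  exact inv_injective ((ENNReal.mul_right_inj (by simp; omega) (by simp)).1 hpq)

theorem toReal_of_admissible (hn : 3 ≤ n) (hp : 2 ≤ p) (hq : 2 ≤ q)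
    (hpq : 2 / p + (n : ℝ≥0∞) / q = (n : ℝ≥0∞) / 2) :
    2 / p.toReal + n / q.toReal = (n : ℝ) / 2 := by
  have hqt := ne_top_of_admissible hn hp hpq
  have h := congrArg ENNReal.toReal hpq
  rw [ENNReal.toReal_add (ENNReal.div_ne_top (by simp) (by positivity))
    (ENNReal.div_ne_top (by simp) (by positivity))] at h
  simpa using h

theorem eLpNorm_rpow_le_of_admissible {r : ℝ≥0∞} (hn : 3 ≤ n) (hp : 2 ≤ p) (hpt : p ≠ ⊤)
    (hq : 2 ≤ q) (hpq : 2 / p + (n : ℝ≥0∞) / q = (n : ℝ≥0∞) / 2) (hr0 : r ≠ 0) (hrt : r ≠ ⊤)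
    (hr : r.toReal = 2 * n / (n - 2)) {u : Rn n → ℂ} (hu : Measurable u) :
    eLpNorm u q volume ^ p.toReal ≤
      eLpNorm u 2 volume ^ (p.toReal - 2) * eLpNorm u r volume ^ 2 := by
  have hqt := ne_top_of_admissible hn hp hpq
  have hq0 : q ≠ 0 := by positivity
  have h := toReal_of_admissible hn hp hq hpq
  have hp2 : 2 ≤ p.toReal := by simpa using (ENNReal.toReal_le_toReal (by simp) hpt).2 hp
  have hq2 : 2 ≤ q.toReal := by simpa using (ENNReal.toReal_le_toReal (by simp) hqt).2 hq
  have hn3 : (3 : ℝ) ≤ n := by exact_mod_cast hn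
  set P := p.toReal
  set Q := q.toReal
  set a := (P - 2) * Q / (2 * P) with ha
  set b := 2 * Q / (r.toReal * P) with hb
  have hr2 : 0 < r.toReal := ENNReal.toReal_pos hr0 hrt
  have ha0 : 0 ≤ a := div_nonneg (mul_nonneg (by linarith) (by linarith)) (by linarith)
  have hb0 : 0 ≤ b := by positivity
  have hn2 : (n : ℝ) - 2 ≠ 0 := by linarith
  have hab : a + b = 1 := by
    rw [ha, hb, hr]
    field_simp at h ⊢
    linarith
  have hab2 : 2 * a + r.toReal * b = Q := by
    rw [ha, hb]
    field_simp
    ring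
  have h1 : ∫⁻ x, ‖u x‖ₑ ^ Q ≤ (∫⁻ x, ‖u x‖ₑ ^ 2) ^ a * (∫⁻ x, ‖u x‖ₑ ^ r.toReal) ^ b := by
    refine le_trans (lintegral_mono fun x => ?_)
      (ENNReal.lintegral_mul_norm_pow_le (hu.enorm.pow_const 2).aemeasurable
        (hu.enorm.pow_const r.toReal).aemeasurable ha0 hb0 hab)
    rw [← ENNReal.rpow_two, ← ENNReal.rpow_mul, ← ENNReal.rpow_mul,
      ← ENNReal.rpow_add_of_nonneg _ _ (by positivity) (by positivity), hab2]
  rw [← eLpNorm_rpow_toReal hq0 hqt, ← eLpNorm_rpow_toReal hr0 hrt, ← eLpNorm_two_sq,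
    ← ENNReal.rpow_two, ← ENNReal.rpow_mul, ← ENNReal.rpow_mul] at h1
  have h2 := ENNReal.rpow_le_rpow h1 (z := P / Q) (by positivity)
  rw [ENNReal.mul_rpow_of_nonneg _ _ (by positivity), ← ENNReal.rpow_mul, ← ENNReal.rpow_mul,
    ← ENNReal.rpow_mul] at h2
  rw [← ENNReal.rpow_two (eLpNorm u r volume)]
  convert h2 using 3
  · field_simp
    rfl
  · rw [ha]; field_simp
  · rw [hb]; field_simp

end Interpolation

theorem IsSource.mixedNorm_duhamel_le {n : ℕ} {f : ℝ → Rn n → ℂ} {p q : ℝ≥0∞} (hn : 3 ≤ n)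
    (hp : 2 ≤ p) (hq : 2 ≤ q) (hpq : 2 / p + (n : ℝ≥0∞) / q = (n : ℝ≥0∞) / 2) (hf : IsSource f) :
    mixedNorm p q (duhamel f) ≤
      superposeConst n 1 ^ (1 / p.toReal) * eLpNorm (superpose f) 2 volume := by
  unfold mixedNorm
  split_ifs with hpt
  · subst hpt
    obtain rfl := eq_two_of_admissible_top hn hpq
    refine essSup_le_of_ae_le _ (Eventually.of_forall fun t => ?_)
    simpa using hf.eLpNorm_duhamel_le t
  · set r := ENNReal.ofReal (2 * n / (n - 2)) with hrdef
    have hn3 : (3 : ℝ) ≤ n := by exact_mod_cast hn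
    have hn2 : 0 < (n : ℝ) - 2 := by linarith
    have hr : r.toReal = 2 * n / (n - 2) := ENNReal.toReal_ofReal (by positivity)
    have hr0 : r ≠ 0 := (ENNReal.ofReal_pos.2 (by positivity)).ne'
    have hrt : r ≠ ⊤ := ENNReal.ofReal_ne_top
    have hp2 : 2 ≤ p.toReal := by simpa using (ENNReal.toReal_le_toReal (by simp) hpt).2 hp
    have hA := hf.eLpNorm_superpose_ne_top
    set A := eLpNorm (superpose f) 2 volume
    have hm := measurable_duhamel hf.measurable
    calc (∫⁻ t, eLpNorm (duhamel f t) q volume ^ p.toReal) ^ (1 / p.toReal)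
        ≤ (∫⁻ t, A ^ (p.toReal - 2) * eLpNorm (duhamel f t) r volume ^ 2) ^ (1 / p.toReal) := by
          gcongr with t
          refine (eLpNorm_rpow_le_of_admissible hn hp hpt hq hpq hr0 hrt hr
            (measurable_slice hm t)).trans ?_
          gcongr
          exact hf.eLpNorm_duhamel_le t
      _ ≤ (A ^ (p.toReal - 2) * (superposeConst n 1 * A ^ 2)) ^ (1 / p.toReal) := by
          rw [lintegral_const_mul' _ _ (ENNReal.rpow_ne_top_of_nonneg (by linarith) hA)]
          gcongr
          refine hf.lintegral_eLpNorm_duhamel_sq_le hn hr0 hrt (α := 2 / (n - 2)) (by positivity)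
            ?_ ?_
          · rw [hr]
            ring
          · rw [hr]
            field_simp
            ring
      _ = superposeConst n 1 ^ (1 / p.toReal) * A := by
          rw [mul_left_comm, ← ENNReal.rpow_two, ← ENNReal.rpow_add_of_nonneg _ _ (by linarith)
            (by norm_num), sub_add_cancel, ENNReal.mul_rpow_of_nonneg _ _ (by positivity),
            ← ENNReal.rpow_mul, mul_one_div_cancel (by linarith), ENNReal.rpow_one]

/-- Untruncated Strichartz-smoothing estimate (all admissible pairs, including
the endpoint `p = 2`): for `|w(x)| ≤ ⟨x⟩⁻¹`,
`‖∫_ℝ e^{i(t-s)Δ}(w g(s,·)) ds‖_{L^p_t L^q_x} ≤ C ‖g‖_{L²(ℝ×ℝⁿ)}`. -/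
theorem strichartz_smoothing_untruncated (n : ℕ) (hn : 3 ≤ n) (p q : ℝ≥0∞)
    (hp : 2 ≤ p) (hq : 2 ≤ q) (hpq : 2 / p + (n : ℝ≥0∞) / q = (n : ℝ≥0∞) / 2) :
    ∃ C : ℝ≥0∞, C ≠ ⊤ ∧
      ∀ w : EuclideanSpace ℝ (Fin n) → ℂ, Measurable w →
        (∀ x, ‖w x‖ ≤ (1 + ‖x‖ ^ 2) ^ (-(1 : ℝ) / 2)) →
        ∀ g : 𝓢(ℝ × EuclideanSpace ℝ (Fin n), ℂ),
          mixedNorm p q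
              (fun t x => ∫ s : ℝ, schrod n (t - s) (fun y => w y * g (s, y)) x)
            ≤ C * eLpNorm (⇑g) 2 volume := by
  set c := superposeConst n (volume (Metric.ball (0 : Rn n) 1)) with hc
  refine ⟨superposeConst n 1 ^ (1 / p.toReal) * c ^ (1 / 2 : ℝ), ENNReal.mul_ne_top
    (ENNReal.rpow_ne_top_of_nonneg (by positivity) (superposeConst_ne_top n ENNReal.one_ne_top))
    (ENNReal.rpow_ne_top_of_nonneg (by norm_num)
      (superposeConst_ne_top n measure_ball_lt_top.ne)), fun w hw hw1 g => ?_⟩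
  have hf : IsSource fun t x => w x * g (t, x) := isSource_mul_schwartz hw (fun x => (hw1 x).trans
    (Real.rpow_le_one_of_one_le_of_nonpos (by nlinarith [norm_nonneg x]) (by norm_num))) g
  refine (hf.mixedNorm_duhamel_le hn hp hq hpq).trans ?_
  rw [mul_assoc]
  gcongr
  rw [← ENNReal.pow_le_pow_left_iff two_ne_zero, mul_pow, ENNReal.rpow_half_sq]
  exact eLpNorm_superpose_mul_schwartz_sq_le hn hw hw1 g
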